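/- arXiv:2503.14285 — 8 statements merged into one kernel-verified Lean document; each statement's English description precedes it below -/
import Mathlib

section
/- Let q = p^d where p is an odd prime, and let M be a regular matroid without loops on a finite ground set E. For each weight vector α ∈ (𝔽_q^*)^E, let A*(α) ⊆ E be any subset of maximum cardinality among subsets A with s̄(M|A;α) ≠ 0, and set r*(α) = |A*(α)| − r(E). Then, as an identity in ℚ, χ_M(q) = ∑_{α ∈ (𝔽_q^*)^E} g(q, r*(α)) · η( s̄(M|A*(α); α) ). -/
/-!
STATEMENT 0: α-representation of the characteristic polynomial of a
regular loopless matroid (Theorem 1 of the paper).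
-/

namespace AlphaRepr

/-- A matroid on a finite ground set `E`, given by its rank function. -/
structure Matroid (E : Type) [Fintype E] [DecidableEq E] where
  r : Finset E → ℕ
  r_le_card : ∀ A : Finset E, r A ≤ A.card
  r_mono : ∀ ⦃A B : Finset E⦄, A ⊆ B → r A ≤ r B
  r_submod : ∀ A B : Finset E, r (A ∪ B) + r (A ∩ B) ≤ r A + r B

variable {E : Type} [Fintype E] [DecidableEq E]

/-- The bases of the restriction `M|A`: maximal independent subsets of `A`,
i.e. sets `B ⊆ A` with `r B = |B|` and `r B = r A`. -/
def restrBases (M : Matroid E) (A : Finset E) : Finset (Finset E) :=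
  A.powerset.filter fun B => M.r B = B.card ∧ M.r B = M.r A

/-- `s̄(M|A;α) = ∑_{B base of M|A} ∏_{e ∈ A \ B} α_e`. -/
def sbar {F : Type} [Field F] (M : Matroid E) (A : Finset E) (α : E → F) : F :=
  ∑ B ∈ restrBases M A, ∏ e ∈ A \ B, α e

/-- The value of the characteristic polynomial
`χ(x) = ∑_{A ⊆ E} (−1)^{|A|} x^{r(E) − r(A)}` of the rank function `r` at `x`. -/
def charPolyVal (r : Finset E → ℕ) (x : ℚ) : ℚ :=
  ∑ A : Finset E, (-1 : ℚ) ^ A.card * x ^ (r Finset.univ - r A)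

/-- `M` is representable over a field `F`: some matrix over `F` whose columns are
indexed by `E` realizes the rank function of `M` as the rank of column sets. -/
def Representable (M : Matroid E) (F : Type) [Field F] : Prop :=
  ∃ (n : ℕ) (A : Matrix (Fin n) E F),
    ∀ S : Finset E, M.r S = (A.submatrix id (fun x : S => (x : E))).rank

/-- `M` is regular: representable over every field. -/
def Regular (M : Matroid E) : Prop :=
  ∀ (F : Type) [Field F], Representable M F

/-- `g(q,m) = η(−1)^{m/2} q^{−m/2}` for even `m`, `g(q,m) = 0` for odd `m`,
where `q` is the cardinality of the field `F` and `η` its quadratic character. -/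
noncomputable def g (F : Type) [Field F] [Fintype F] [DecidableEq F] (m : ℕ) : ℚ :=
  if Even m then
    ((quadraticChar F (-1) : ℤ) : ℚ) ^ (m / 2) * ((Fintype.card F : ℚ))⁻¹ ^ (m / 2)
  else 0

/-- Expansion of the determinant of `N * diagonal β * Nᵀ` over column choices. -/
lemma det_mul_diagonal_mul_transpose {R E : Type*} [CommRing R] [Fintype E] [DecidableEq E]
    {r : ℕ} (N : Matrix (Fin r) E R) (β : E → R) :
    (N * Matrix.diagonal β * N.transpose).det =
      ∑ c : Fin r → E, (∏ i, β (c i)) * ((∏ i, N i (c i)) * (N.submatrix id c).det) := by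
  have h : (N * Matrix.diagonal β * N.transpose) =
      fun i => ∑ e, (N i e * β e) • N.transpose e := by
    ext i j
    rw [Matrix.mul_apply]
    simp [Matrix.mul_diagonal, Finset.sum_apply]
  have h2 := MultilinearMap.map_sum
    (Matrix.detRowAlternating (R := R) (n := Fin r)).toMultilinearMap
    (fun i e => (N i e * β e) • N.transpose e)
  rw [h]
  refine h2.trans (Finset.sum_congr rfl fun c _ => ?_)
  rw [MultilinearMap.map_smul_univ, Finset.prod_mul_distrib, smul_eq_mul]
  have : (Matrix.detRowAlternating (R := R) (n := Fin r)).toMultilinearMap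
      (fun i => N.transpose (c i)) = (N.submatrix id c).det := by
    rw [← Matrix.det_transpose]
    rfl
  rw [this]
  ring

/-- The Cauchy–Binet formula for a symmetric product, when the squares of the maximal minors
are `0` or `1`. -/
lemma det_mul_diagonal_mul_transpose_of_sq {R E : Type*} [CommRing R] [Fintype E]
    [DecidableEq E] {r : ℕ} (N : Matrix (Fin r) E R) (β : E → R) (Q : Finset E → Prop)
    [DecidablePred Q]
    (hN : ∀ c : Fin r → E, c.Injective →
      (N.submatrix id c).det ^ 2 = if Q (Finset.univ.image c) then 1 else 0) :
    (N * Matrix.diagonal β * N.transpose).det =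
      ∑ B ∈ (Finset.powersetCard r Finset.univ).filter Q, ∏ e ∈ B, β e := by
  classical
  rw [det_mul_diagonal_mul_transpose]
  have hinj : ∀ c : Fin r → E, c ∈ Finset.univ →
      (∏ i, β (c i)) * ((∏ i, N i (c i)) * (N.submatrix id c).det) ≠ 0 → c.Injective := by
    intro c _ hc
    by_contra hni
    obtain ⟨i, j, hij, hne⟩ := Function.not_injective_iff.1 hni
    refine hc ?_
    rw [Matrix.det_zero_of_column_eq hne (by simp [hij])]
    simp
  rw [← Finset.sum_filter_of_ne hinj]
  have hmaps : ∀ c ∈ Finset.univ.filter (fun c : Fin r → E => c.Injective),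
      Finset.univ.image c ∈ Finset.powersetCard r (Finset.univ : Finset E) := by
    intro c hc
    rw [Finset.mem_filter] at hc
    simp [Finset.mem_powersetCard, Finset.card_image_of_injective _ hc.2]
  rw [← Finset.sum_fiberwise_of_maps_to hmaps, Finset.sum_filter]
  refine Finset.sum_congr rfl fun B hB => ?_
  rw [Finset.mem_powersetCard] at hB
  obtain ⟨-, hB⟩ := hB
  let φ : Fin r ≃ B := (finCongr hB.symm).trans B.equivFin.symm
  let c₀ : Fin r → E := fun i => φ i
  have hc₀ : c₀.Injective := fun i j h => φ.injective (Subtype.ext h)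
  have himg : Finset.univ.image c₀ = B := by
    ext e
    simp only [Finset.mem_image, Finset.mem_univ, true_and]
    constructor
    · rintro ⟨i, rfl⟩
      exact (φ i).2
    · intro he
      exact ⟨φ.symm ⟨e, he⟩, by simp [c₀]⟩
  have hsum : ∑ c ∈ (Finset.univ.filter (fun c : Fin r → E => c.Injective)).filter
        (fun c => Finset.univ.image c = B),
        (∏ i, β (c i)) * ((∏ i, N i (c i)) * (N.submatrix id c).det) =
      ∑ σ : Equiv.Perm (Fin r), (∏ e ∈ B, β e) *
        ((N.submatrix id c₀).det * (Equiv.Perm.sign σ * ∏ i, N i (c₀ (σ i)))) := by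
    symm
    refine Finset.sum_bij (fun σ _ => c₀ ∘ σ) ?_ ?_ ?_ ?_
    · intro σ _
      simp only [Finset.mem_filter, Finset.mem_univ, true_and]
      refine ⟨hc₀.comp σ.injective, ?_⟩
      rw [← himg, ← Finset.image_image, Finset.image_univ_equiv]
    · intro σ _ τ _ h
      ext i
      exact congrArg Fin.val (hc₀ (congrFun h i))
    · intro c hc
      simp only [Finset.mem_filter, Finset.mem_univ, true_and] at hc
      have hex : ∀ i, ∃ j, c₀ j = c i := by
        intro i
        have : c i ∈ Finset.univ.image c₀ := by
          rw [himg, ← hc.2]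
          exact Finset.mem_image_of_mem _ (Finset.mem_univ _)
        simpa using this
      choose s hs using hex
      have hsinj : s.Injective := by
        intro i j h
        apply hc.1
        rw [← hs i, ← hs j, h]
      refine ⟨Equiv.ofBijective s (Finite.injective_iff_bijective.1 hsinj),
        Finset.mem_univ _, ?_⟩
      funext i
      exact hs i
    · intro σ _
      have h1 : (N.submatrix id (c₀ ∘ σ)).det =
          Equiv.Perm.sign σ * (N.submatrix id c₀).det := by
        rw [← Matrix.det_permute' σ (N.submatrix id c₀)]
        rfl
      have h2 : ∏ i, β ((c₀ ∘ σ) i) = ∏ e ∈ B, β e := by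
        rw [← himg, Finset.prod_image (fun i _ j _ h => hc₀ h)]
        exact Equiv.prod_comp σ (fun i => β (c₀ i))
      rw [h1, h2]
      simp only [Function.comp]
      ring
  rw [hsum, ← Finset.mul_sum, ← Finset.mul_sum]
  have hdet : ∑ σ : Equiv.Perm (Fin r), ((Equiv.Perm.sign σ : ℤ) : R) * ∏ i, N i (c₀ (σ i)) =
      (N.submatrix id c₀).det := by
    rw [← Matrix.det_transpose, Matrix.det_apply']
    rfl
  rw [hdet, ← sq, hN c₀ hc₀, himg]
  split_ifs <;> simp

/-- The quadratic character of `F` with values in a field `K`. -/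
noncomputable def quadCharTo (F K : Type*) [Field F] [Fintype F] [DecidableEq F] [Field K] :
    MulChar F K :=
  (quadraticChar F).ringHomComp (Int.castRingHom K)

section Gauss

variable {F K : Type*} [Field F] [Fintype F] [DecidableEq F] [Field K]

lemma quadCharTo_apply (a : F) : quadCharTo F K a = ((quadraticChar F a : ℤ) : K) := rfl

lemma quadCharTo_sq {a : F} (ha : a ≠ 0) : quadCharTo F K (a ^ 2) = 1 := by
  rw [quadCharTo_apply, quadraticChar_sq_one' ha, Int.cast_one]

lemma quadCharTo_mul_self {a : F} (ha : a ≠ 0) : quadCharTo F K a * quadCharTo F K a = 1 := by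
  rw [← map_mul, ← sq, quadCharTo_sq ha]

lemma quadCharTo_inv (a : F) : quadCharTo F K a⁻¹ = quadCharTo F K a := by
  by_cases ha : a = 0
  · simp [ha]
  · have h : quadCharTo F K a * quadCharTo F K a⁻¹ = 1 := by
      rw [← map_mul, mul_inv_cancel₀ ha, map_one]
    have h2 := quadCharTo_mul_self (K := K) ha
    calc quadCharTo F K a⁻¹
        = (quadCharTo F K a * quadCharTo F K a) * quadCharTo F K a⁻¹ := by rw [h2, one_mul]
      _ = quadCharTo F K a := by rw [mul_assoc, h, mul_one]

lemma quadCharTo_ne_one [CharZero K] (hF : ringChar F ≠ 2) : quadCharTo F K ≠ 1 :=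
  (MulChar.ringHomComp_ne_one_iff (RingHom.injective_int _)).2 (quadraticChar_ne_one hF)

/-- The quadratic Gauss sum. -/
noncomputable def quadGauss (ψ : AddChar F K) : K := gaussSum (quadCharTo F K) ψ

variable {ψ : AddChar F K}

lemma sum_quadCharTo_mul (a : F) (ha : a ≠ 0) :
    ∑ x, quadCharTo F K x * ψ (a * x) = quadCharTo F K a * quadGauss ψ := by
  have h := gaussSum_mulShift (quadCharTo F K) ψ (Units.mk0 a ha)
  rw [Units.val_mk0] at h
  rw [quadGauss, ← h, ← mul_assoc, quadCharTo_mul_self ha, one_mul]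
  simp [gaussSum, AddChar.mulShift_apply]

variable [CharZero K]

lemma quadGauss_sq (hF : ringChar F ≠ 2) (hψ : ψ.IsPrimitive) :
    quadGauss ψ ^ 2 = quadCharTo F K (-1) * Fintype.card F :=
  gaussSum_sq (quadCharTo_ne_one hF) ((quadraticChar_isQuadratic F).comp _) hψ

lemma quadGauss_ne_zero (hF : ringChar F ≠ 2) (hψ : ψ.IsPrimitive) : quadGauss ψ ≠ 0 :=
  gaussSum_ne_zero_of_nontrivial (by simp) (quadCharTo_ne_one hF) hψ

lemma sum_addChar_mul_sq (hF : ringChar F ≠ 2) (hψ : ψ.IsPrimitive) {a : F} (ha : a ≠ 0) :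
    ∑ t, ψ (a * t ^ 2) = quadCharTo F K a * quadGauss ψ := by
  classical
  have h0 : ∑ x, ψ (a * x) = 0 := by
    have := AddChar.sum_eq_zero_of_ne_one (hψ ha)
    simpa [AddChar.mulShift_apply] using this
  calc ∑ t, ψ (a * t ^ 2)
      = ∑ x, ∑ t ∈ Finset.univ.filter (fun t : F => t ^ 2 = x), ψ (a * t ^ 2) :=
        (Finset.sum_fiberwise _ _ _).symm
    _ = ∑ x, (quadCharTo F K x + 1) * ψ (a * x) := by
        refine Finset.sum_congr rfl fun x _ => ?_
        rw [Finset.sum_congr rfl (g := fun _ => ψ (a * x))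
          (by intro t ht; rw [(Finset.mem_filter.1 ht).2]), Finset.sum_const, nsmul_eq_mul]
        congr 1
        have h := quadraticChar_card_sqrts hF x
        rw [Set.toFinset_ofPred] at h
        rw [quadCharTo_apply]
        exact_mod_cast congrArg (Int.cast : ℤ → K) h
    _ = _ := by
        simp only [add_mul, one_mul, Finset.sum_add_distrib]
        rw [h0, add_zero, sum_quadCharTo_mul a ha]

lemma sum_quadCharTo_mul_inv (hF : ringChar F ≠ 2) (w : F) :
    ∑ a, quadCharTo F K a * ψ (a⁻¹ * w ^ 2) = if w = 0 then 0 else quadGauss ψ := by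
  have h : ∑ a, quadCharTo F K a * ψ (a⁻¹ * w ^ 2) =
      ∑ a, quadCharTo F K a * ψ (w ^ 2 * a) := by
    rw [← Equiv.sum_comp (Equiv.inv F)]
    refine Finset.sum_congr rfl fun a _ => ?_
    simp [quadCharTo_inv, mul_comm]
  rw [h]
  split_ifs with hw
  · simpa [hw] using MulChar.sum_eq_zero_of_ne_one (quadCharTo_ne_one (K := K) hF)
  · rw [sum_quadCharTo_mul _ (pow_ne_zero 2 hw), quadCharTo_sq hw, one_mul]

lemma exists_diagonalization {F : Type*} [Field F] (h2 : (2 : F) ≠ 0) {r : ℕ}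
    {S : Matrix (Fin r) (Fin r) F} (hS : S.IsSymm) :
    ∃ (P : Matrix (Fin r) (Fin r) F) (d : Fin r → F), IsUnit P ∧
      P.transpose * S * P = Matrix.diagonal d := by
  have : Invertible (2 : F) := invertibleOfNonzero h2
  obtain ⟨v, hv⟩ := LinearMap.BilinForm.exists_orthogonal_basis
    (B := Matrix.toBilin' S) (LinearMap.BilinForm.isSymm_iff.1 (Matrix.isSymm_toBilin'_iff_isSymm.2 hS))
  have hr : Module.finrank F (Fin r → F) = r := by simp
  let w := v.reindex (finCongr hr)
  let P := (Pi.basisFun F (Fin r)).toMatrix w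
  have hP : ∀ i j, P i j = w j i := fun i j => by simp [P, Module.Basis.toMatrix_apply]
  have := (Pi.basisFun F (Fin r)).invertibleToMatrix w
  refine ⟨P, fun i => (P.transpose * S * P) i i, isUnit_of_invertible P, ?_⟩
  ext i j
  by_cases hij : i = j
  · simp [hij]
  · rw [Matrix.diagonal_apply_ne _ hij]
    have h1 : (P.transpose * S * P) i j = Matrix.toBilin' S (w i) (w j) := by
      rw [Matrix.toBilin'_apply', Matrix.mul_assoc, Matrix.mul_apply]
      simp [dotProduct, Matrix.mul_apply, Matrix.mulVec, hP]
    rw [h1]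
    have := hv (i := (finCongr hr).symm i) (j := (finCongr hr).symm j) (by simpa using hij)
    simpa [w, Function.onFun] using this

lemma addChar_map_sum {A R ι : Type*} [AddCommMonoid A] [CommMonoid R] (ψ : AddChar A R)
    (s : Finset ι) (f : ι → A) : ψ (∑ i ∈ s, f i) = ∏ i ∈ s, ψ (f i) := by
  classical
  induction s using Finset.induction_on with
  | empty => simp
  | insert a s ha ih =>
    rw [Finset.sum_insert ha, Finset.prod_insert ha, AddChar.map_add_eq_mul, ih]

/-- The Gauss sum of a quadratic form. -/
noncomputable def formGauss {n : Type*} [Fintype n] [DecidableEq n] (ψ : AddChar F K)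
    (S : Matrix n n F) : K :=
  ∑ y : n → F, ψ (y ⬝ᵥ S.mulVec y)

lemma sum_prod_eq_prod_sum {F R n : Type*} [Fintype F] [CommSemiring R] [Fintype n]
    [DecidableEq n] (f : n → F → R) :
    ∑ y : n → F, ∏ i, f i (y i) = ∏ i, ∑ t, f i t := by
  rw [Finset.prod_univ_sum, Fintype.piFinset_univ]

lemma formGauss_diagonal (hF : ringChar F ≠ 2) (hψ : ψ.IsPrimitive) {n : Type*} [Fintype n]
    [DecidableEq n] {d : n → F} (hd : ∀ i, d i ≠ 0) :
    formGauss ψ (Matrix.diagonal d) =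
      quadCharTo F K (∏ i, d i) * quadGauss ψ ^ Fintype.card n := by
  have h : ∀ y : n → F, ψ (y ⬝ᵥ (Matrix.diagonal d).mulVec y) = ∏ i, ψ (d i * y i ^ 2) := by
    intro y
    rw [← addChar_map_sum]
    congr 1
    simp only [dotProduct, Matrix.mulVec_diagonal]
    exact Finset.sum_congr rfl fun i _ => by ring
  rw [formGauss, Finset.sum_congr rfl fun y _ => h y,
    sum_prod_eq_prod_sum (fun i t => ψ (d i * t ^ 2)),
    Finset.prod_congr rfl fun i _ => sum_addChar_mul_sq hF hψ (hd i),
    Finset.prod_mul_distrib, map_prod, Finset.prod_const, Finset.card_univ]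

lemma formGauss_of_det_ne_zero (hF : ringChar F ≠ 2) (hψ : ψ.IsPrimitive) {r : ℕ}
    {S : Matrix (Fin r) (Fin r) F} (hS : S.IsSymm) (hdet : S.det ≠ 0) :
    formGauss ψ S = quadCharTo F K S.det * quadGauss ψ ^ r := by
  obtain ⟨P, d, hP, hd⟩ := exists_diagonalization (Ring.two_ne_zero hF) hS
  have hPdet : P.det ≠ 0 := ((Matrix.isUnit_iff_isUnit_det P).1 hP).ne_zero
  have hprod : ∏ i, d i = P.det ^ 2 * S.det := by
    rw [← Matrix.det_diagonal, ← hd, Matrix.det_mul, Matrix.det_mul, Matrix.det_transpose]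
    ring
  have hd0 : ∀ i, d i ≠ 0 := by
    have : ∏ i, d i ≠ 0 := hprod ▸ mul_ne_zero (pow_ne_zero 2 hPdet) hdet
    exact fun i => Finset.prod_ne_zero_iff.1 this i (Finset.mem_univ i)
  have hbij : Function.Bijective P.mulVec :=
    Finite.injective_iff_bijective.1 (Matrix.mulVec_injective_of_isUnit hP)
  have h : formGauss ψ S = formGauss ψ (Matrix.diagonal d) := by
    rw [formGauss, formGauss]
    symm
    refine Fintype.sum_bijective P.mulVec hbij _ _ fun y => ?_
    rw [← hd, ← Matrix.mulVec_mulVec, ← Matrix.mulVec_mulVec, Matrix.mulVec_transpose,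
      dotProduct_comm, ← Matrix.dotProduct_mulVec, dotProduct_comm]
  rw [h, formGauss_diagonal hF hψ hd0, hprod, map_mul, quadCharTo_sq hPdet, one_mul,
    Fintype.card_fin]

section Degenerate

open Matrix

lemma complete_square {F n T : Type*} [Field F] [Fintype n] [DecidableEq n] [Fintype T]
    [DecidableEq T]
    {S : Matrix n n F} (hS : S.IsSymm) (hdet : S.det ≠ 0) (U : Matrix n T F) {d : T → F}
    (hd : ∀ e, d e ≠ 0) (hK : Uᵀ * S⁻¹ * U = -diagonal fun e => (d e)⁻¹)
    (y : n → F) (z : T → F) :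
    y ⬝ᵥ (S + U * diagonal d * Uᵀ) *ᵥ y +
        (z - diagonal d *ᵥ Uᵀ *ᵥ y) ⬝ᵥ
          (diagonal fun e => -(d e)⁻¹) *ᵥ (z - diagonal d *ᵥ Uᵀ *ᵥ y) =
      (y + S⁻¹ *ᵥ U *ᵥ z) ⬝ᵥ S *ᵥ (y + S⁻¹ *ᵥ U *ᵥ z) := by
  have hSw : S *ᵥ S⁻¹ *ᵥ U *ᵥ z = U *ᵥ z := by
    rw [mulVec_mulVec, mul_nonsing_inv _ (isUnit_iff_ne_zero.2 hdet), one_mulVec]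
  have hcross : (S⁻¹ *ᵥ U *ᵥ z) ⬝ᵥ S *ᵥ y = (Uᵀ *ᵥ y) ⬝ᵥ z := by
    rw [dotProduct_mulVec, ← mulVec_transpose, hS.eq, hSw, mulVec_transpose, dotProduct_comm,
      dotProduct_mulVec]
  have hyU : y ⬝ᵥ U *ᵥ z = (Uᵀ *ᵥ y) ⬝ᵥ z := by
    rw [dotProduct_mulVec, mulVec_transpose]
  have hww : (S⁻¹ *ᵥ U *ᵥ z) ⬝ᵥ U *ᵥ z = -∑ e, (d e)⁻¹ * z e ^ 2 := by
    have : (S⁻¹ *ᵥ U *ᵥ z) ⬝ᵥ U *ᵥ z = z ⬝ᵥ (Uᵀ * S⁻¹ * U) *ᵥ z := by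
      rw [dotProduct_mulVec, ← mulVec_transpose, dotProduct_comm, ← mulVec_mulVec,
        ← mulVec_mulVec]
    rw [this, hK, neg_mulVec, dotProduct_neg]
    simp only [dotProduct, mulVec_diagonal]
    congr 1
    exact Finset.sum_congr rfl fun e _ => by ring
  have hyD : y ⬝ᵥ (U * diagonal d * Uᵀ) *ᵥ y = ∑ e, d e * (Uᵀ *ᵥ y) e ^ 2 := by
    rw [← mulVec_mulVec, ← mulVec_mulVec, dotProduct_mulVec, ← mulVec_transpose]
    simp only [dotProduct, mulVec_diagonal]
    exact Finset.sum_congr rfl fun e _ => by ring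
  rw [add_mulVec, dotProduct_add, hyD, mulVec_add, dotProduct_add, add_dotProduct,
    add_dotProduct, hSw, hcross, hyU, hww]
  have hsq : (z - diagonal d *ᵥ Uᵀ *ᵥ y) ⬝ᵥ
      (diagonal fun e => -(d e)⁻¹) *ᵥ (z - diagonal d *ᵥ Uᵀ *ᵥ y) =
      -∑ e, d e * (Uᵀ *ᵥ y) e ^ 2 + ((Uᵀ *ᵥ y) ⬝ᵥ z + (Uᵀ *ᵥ y) ⬝ᵥ z)
        - ∑ e, (d e)⁻¹ * z e ^ 2 := by
    simp only [dotProduct, mulVec_diagonal, Pi.sub_apply]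
    rw [← Finset.sum_neg_distrib, ← Finset.sum_add_distrib, ← Finset.sum_add_distrib,
      ← Finset.sum_sub_distrib]
    refine Finset.sum_congr rfl fun e _ => ?_
    have := hd e
    field_simp
    ring
  rw [hsq]
  ring

lemma formGauss_add_mul {F K n T : Type*} [Field F] [Fintype F] [Field K] {ψ : AddChar F K}
    [Fintype n] [DecidableEq n] [Fintype T] [DecidableEq T]
    {S : Matrix n n F} (hS : S.IsSymm) (hdet : S.det ≠ 0) (U : Matrix n T F) {d : T → F}
    (hd : ∀ e, d e ≠ 0) (hK : Uᵀ * S⁻¹ * U = -diagonal fun e => (d e)⁻¹) :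
    formGauss ψ (S + U * diagonal d * Uᵀ) * formGauss ψ (diagonal fun e => -(d e)⁻¹) =
      (Fintype.card F : K) ^ Fintype.card T * formGauss ψ S := by
  have h1 : ∀ y : n → F, formGauss ψ (diagonal fun e => -(d e)⁻¹) =
      ∑ z : T → F, ψ ((z - diagonal d *ᵥ Uᵀ *ᵥ y) ⬝ᵥ
          (diagonal fun e => -(d e)⁻¹) *ᵥ (z - diagonal d *ᵥ Uᵀ *ᵥ y)) := fun y =>
    (Equiv.sum_comp (Equiv.subRight (diagonal d *ᵥ Uᵀ *ᵥ y)) fun z : T → F =>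
      ψ (z ⬝ᵥ (diagonal fun e => -(d e)⁻¹) *ᵥ z)).symm
  have h2 : ∀ z : T → F, ∑ y : n → F,
      ψ ((y + S⁻¹ *ᵥ U *ᵥ z) ⬝ᵥ S *ᵥ (y + S⁻¹ *ᵥ U *ᵥ z)) = formGauss ψ S := fun z =>
    Equiv.sum_comp (Equiv.addRight (S⁻¹ *ᵥ U *ᵥ z)) fun y : n → F => ψ (y ⬝ᵥ S *ᵥ y)
  calc _ = ∑ y : n → F, ∑ z : T → F,
        ψ ((y + S⁻¹ *ᵥ U *ᵥ z) ⬝ᵥ S *ᵥ (y + S⁻¹ *ᵥ U *ᵥ z)) := by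
        rw [formGauss, Finset.sum_mul]
        refine Finset.sum_congr rfl fun y _ => ?_
        rw [h1 y, Finset.mul_sum]
        refine Finset.sum_congr rfl fun z _ => ?_
        rw [← AddChar.map_add_eq_mul, complete_square hS hdet U hd hK]
    _ = _ := by
        rw [Finset.sum_comm, Finset.sum_congr rfl fun z _ => h2 z, Finset.sum_const,
          nsmul_eq_mul, Finset.card_univ, Fintype.card_fun, Nat.cast_pow]

/-- If all rank one and rank two updates of an invertible `S` by the columns of `U` with weights
`d` are singular, then the associated Schur complement vanishes. -/
lemma schur_eq_zero {F n T : Type*} [Field F] [Fintype n] [DecidableEq n] [DecidableEq T]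
    {S : Matrix n n F} (hS : S.IsSymm) (hdet : S.det ≠ 0) (U : Matrix n T F) {d : T → F}
    (hd : ∀ e, d e ≠ 0)
    (h1 : ∀ e, (S + of fun i j => d e * U i e * U j e).det = 0)
    (h2 : ∀ e f, e ≠ f →
      (S + of fun i j => d e * U i e * U j e + d f * U i f * U j f).det = 0) :
    Uᵀ * S⁻¹ * U = -diagonal fun e => (d e)⁻¹ := by
  have hunit : IsUnit S.det := isUnit_iff_ne_zero.2 hdet
  have hsymm : ∀ e f, (Uᵀ * S⁻¹ * U) e f = (Uᵀ * S⁻¹ * U) f e := by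
    have : (Uᵀ * S⁻¹ * U)ᵀ = Uᵀ * S⁻¹ * U := by
      rw [transpose_mul, transpose_mul, transpose_transpose, transpose_nonsing_inv, hS.eq,
        Matrix.mul_assoc]
    exact fun e f => congrFun (congrFun this f) e
  have key : ∀ {m : ℕ} (c : Fin m → T),
      (S + of fun i j => ∑ a, d (c a) * U i (c a) * U j (c a)).det = 0 →
      (1 + of fun a b => d (c a) * (Uᵀ * S⁻¹ * U) (c a) (c b) : Matrix (Fin m) (Fin m) F).det
        = 0 := by
    intro m c hc
    have hV : (of fun i j => ∑ a, d (c a) * U i (c a) * U j (c a)) =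
        U.submatrix id c * (diagonal (d ∘ c) * (U.submatrix id c)ᵀ) := by
      ext i j
      rw [mul_apply]
      simp only [of_apply, diagonal_mul, submatrix_apply, id, transpose_apply,
        Function.comp]
      exact Finset.sum_congr rfl fun a _ => by ring
    rw [hV, det_add_mul _ _ hunit] at hc
    rcases mul_eq_zero.1 hc with h | h
    · exact absurd h hdet
    · rw [← h]
      congr 2
      ext a b
      rw [Matrix.mul_assoc (diagonal (d ∘ c)), Matrix.mul_assoc (diagonal (d ∘ c)),
        diagonal_mul]
      rfl
  have hdiag : ∀ e, (Uᵀ * S⁻¹ * U) e e = -(d e)⁻¹ := by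
    intro e
    have := key (m := 1) (fun _ => e) (by simpa using h1 e)
    simp only [det_unique, Matrix.add_apply, one_apply_eq, of_apply] at this
    have hde := hd e
    field_simp
    linear_combination this
  ext e f
  by_cases hef : e = f
  · subst hef
    simp [hdiag]
  · have := key (m := 2) ![e, f] (by simpa [Fin.sum_univ_two] using h2 e f hef)
    rw [det_fin_two] at this
    simp [hdiag, hd e, hd f, hsymm f e] at this
    rw [Matrix.neg_apply, diagonal_apply_ne _ hef, neg_zero]
    exact this

end Degenerate

section Gram

open Matrix

variable {E : Type*} [Fintype E] [DecidableEq E] {r : ℕ}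

/-- The Gram matrix `∑ e ∈ A, (α e)⁻¹ N_e N_eᵀ` of the columns of `N` in `A`. -/
noncomputable def gram {F : Type*} [Field F] (N : Matrix (Fin r) E F) (A : Finset E)
    (α : E → F) : Matrix (Fin r) (Fin r) F :=
  N * diagonal (fun e => if e ∈ A then (α e)⁻¹ else 0) * Nᵀ

lemma gram_apply {F : Type*} [Field F] (N : Matrix (Fin r) E F) (A : Finset E) (α : E → F)
    (i j : Fin r) : gram N A α i j = ∑ e ∈ A, (α e)⁻¹ * N i e * N j e := by
  rw [gram, mul_apply, ← Finset.sum_filter_add_sum_filter_not Finset.univ (· ∈ A)]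
  simp only [mul_diagonal, transpose_apply]
  rw [Finset.sum_eq_zero (s := Finset.univ.filter fun e => e ∉ A), add_zero,
    Finset.filter_univ_mem]
  · refine Finset.sum_congr rfl fun e he => ?_
    rw [if_pos he]
    ring
  · intro e he
    rw [if_neg (Finset.mem_filter.1 he).2]
    ring

lemma gram_isSymm {F : Type*} [Field F] (N : Matrix (Fin r) E F) (A : Finset E) (α : E → F) :
    (gram N A α).IsSymm := by
  ext i j
  rw [transpose_apply, gram_apply, gram_apply]
  exact Finset.sum_congr rfl fun e _ => by ring

lemma formGauss_gram (hF : ringChar F ≠ 2) (hψ : ψ.IsPrimitive) (N : Matrix (Fin r) E F)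
    {α : E → F} (hα : ∀ e, α e ≠ 0) {A : Finset E} (hA : (gram N A α).det ≠ 0)
    (hmax : ∀ A', (gram N A' α).det ≠ 0 → A'.card ≤ A.card) :
    quadCharTo F K (∏ e, α e) * formGauss ψ (gram N Finset.univ α) =
      quadGauss ψ ^ (Aᶜ.card + r) * quadCharTo F K ((∏ e ∈ A, α e) * (gram N A α).det) := by
  let T := {e // e ∈ Aᶜ}
  let U : Matrix (Fin r) T F := N.submatrix id Subtype.val
  let d : T → F := fun e => (α e)⁻¹
  have hd : ∀ e, d e ≠ 0 := fun e => inv_ne_zero (hα e)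
  have hsing : ∀ A', A.card < A'.card → (gram N A' α).det = 0 := by
    intro A' h
    by_contra h'
    exact absurd (hmax A' h') (not_le.2 h)
  have hK : Uᵀ * (gram N A α)⁻¹ * U = -diagonal fun e => (d e)⁻¹ := by
    refine schur_eq_zero (gram_isSymm N A α) hA U hd ?_ ?_
    · intro e
      have he := Finset.mem_compl.1 e.2
      rw [← hsing (insert e.1 A) (by rw [Finset.card_insert_of_notMem he]; omega)]
      congr 1
      ext i j
      rw [Matrix.add_apply, gram_apply, gram_apply, Finset.sum_insert he, add_comm]
      rfl
    · intro e f hef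
      have he := Finset.mem_compl.1 e.2
      have hf := Finset.mem_compl.1 f.2
      have hef' : e.1 ∉ insert f.1 A := by
        rw [Finset.mem_insert, not_or]
        exact ⟨fun h => hef (Subtype.ext h), he⟩
      rw [← hsing (insert e.1 (insert f.1 A)) (by
        rw [Finset.card_insert_of_notMem hef', Finset.card_insert_of_notMem hf]; omega)]
      congr 1
      ext i j
      rw [Matrix.add_apply, gram_apply, gram_apply, Finset.sum_insert hef',
        Finset.sum_insert hf, add_comm, ← add_assoc]
      rfl
  have hgram : gram N Finset.univ α = gram N A α + U * diagonal d * Uᵀ := by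
    ext i j
    rw [Matrix.add_apply, gram_apply, gram_apply, ← Finset.sum_add_sum_compl A, mul_apply]
    congr 1
    rw [← Finset.sum_coe_sort Aᶜ]
    refine Finset.sum_congr rfl fun e _ => ?_
    rw [mul_diagonal]
    simp only [U, d, transpose_apply, submatrix_apply, id]
    ring
  have hmain := formGauss_add_mul (ψ := ψ) (gram_isSymm N A α) hA U hd hK
  rw [← hgram, formGauss_diagonal hF hψ fun e => neg_ne_zero.2 (inv_ne_zero (hd e)),
    formGauss_of_det_ne_zero hF hψ (gram_isSymm N A α) hA] at hmain
  have hprod : ∏ e : T, -(d e)⁻¹ = (-1) ^ Aᶜ.card * ∏ e ∈ Aᶜ, α e := by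
    rw [← Finset.prod_coe_sort Aᶜ]
    simp only [d, inv_inv]
    rw [Finset.prod_neg, Finset.card_univ, Fintype.card_coe]
  have hcard : Fintype.card T = Aᶜ.card := Fintype.card_coe _
  rw [hprod, hcard, map_mul, map_pow] at hmain
  have hsq := quadGauss_sq hF hψ
  have hneg := quadCharTo_mul_self (F := F) (K := K) (neg_ne_zero.2 (one_ne_zero (α := F)))
  have hG := pow_ne_zero Aᶜ.card (quadGauss_ne_zero hF hψ)
  have hpow : (quadGauss ψ ^ Aᶜ.card) * (quadGauss ψ ^ Aᶜ.card) =
      quadCharTo F K (-1) ^ Aᶜ.card * (Fintype.card F : K) ^ Aᶜ.card := by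
    rw [← mul_pow, ← sq, hsq, mul_pow]
  have hneg' : quadCharTo F K (-1) ^ Aᶜ.card * quadCharTo F K (-1) ^ Aᶜ.card = 1 := by
    rw [← mul_pow, hneg, one_pow]
  rw [← Finset.prod_mul_prod_compl A, map_mul, map_mul, pow_add]
  apply mul_right_cancel₀ hG
  generalize quadCharTo F K (-1) ^ Aᶜ.card = s at *
  generalize (Fintype.card F : K) ^ Aᶜ.card = Q at *
  generalize quadGauss ψ ^ Aᶜ.card = G at *
  generalize quadGauss ψ ^ r = G' at *
  generalize formGauss ψ (gram N Finset.univ α) = X at *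
  generalize quadCharTo F K (∏ e ∈ A, α e) = a at *
  generalize quadCharTo F K (∏ e ∈ Aᶜ, α e) = b at *
  generalize quadCharTo F K (gram N A α).det = D at *
  linear_combination (a * s) * hmain - (a * b * X * G) * hneg' - (G' * a * D) * hpow

/-- Counting nowhere vanishing row vectors by Gauss sums. -/
lemma quadGauss_pow_mul_card (hF : ringChar F ≠ 2) (N : Matrix (Fin r) E F) :
    quadGauss ψ ^ Fintype.card E *
        ((Finset.univ.filter fun y : Fin r → F => ∀ e, (y ᵥ* N) e ≠ 0).card : K) =
      ∑ α ∈ Finset.univ.filter (fun α : E → F => ∀ e, α e ≠ 0),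
        quadCharTo F K (∏ e, α e) * formGauss ψ (gram N Finset.univ α) := by
  have hform : ∀ (α : E → F) (y : Fin r → F),
      ψ (y ⬝ᵥ gram N Finset.univ α *ᵥ y) = ∏ e, ψ ((α e)⁻¹ * (y ᵥ* N) e ^ 2) := by
    intro α y
    rw [← addChar_map_sum]
    congr 1
    rw [gram, ← mulVec_mulVec, ← mulVec_mulVec, dotProduct_mulVec, mulVec_transpose]
    simp only [Finset.mem_univ, if_true, dotProduct, mulVec_diagonal]
    exact Finset.sum_congr rfl fun e _ => by ring
  have hzero : ∀ α ∈ (Finset.univ : Finset (E → F)),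
      quadCharTo F K (∏ e, α e) * formGauss ψ (gram N Finset.univ α) ≠ 0 → ∀ e, α e ≠ 0 := by
    intro α _ h e he
    refine h ?_
    rw [Finset.prod_eq_zero (Finset.mem_univ e) he, quadCharTo_apply, quadraticChar_zero,
      Int.cast_zero, zero_mul]
  rw [Finset.sum_filter_of_ne hzero]
  have hE : ∀ y : Fin r → F,
      ∑ α : E → F, quadCharTo F K (∏ e, α e) * ψ (y ⬝ᵥ gram N Finset.univ α *ᵥ y) =
        if ∀ e, (y ᵥ* N) e ≠ 0 then quadGauss ψ ^ Fintype.card E else 0 := by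
    intro y
    simp only [hform, map_prod, ← Finset.prod_mul_distrib]
    rw [sum_prod_eq_prod_sum (fun e a => quadCharTo F K a * ψ (a⁻¹ * (y ᵥ* N) e ^ 2)),
      Finset.prod_congr rfl fun e _ => sum_quadCharTo_mul_inv hF _]
    split_ifs with h
    · rw [Finset.prod_congr rfl fun e _ => if_neg (h e), Finset.prod_const, Finset.card_univ]
    · push Not at h
      obtain ⟨e, he⟩ := h
      exact Finset.prod_eq_zero (Finset.mem_univ e) (if_pos he)
  simp only [formGauss, Finset.mul_sum]
  rw [Finset.sum_comm, Finset.sum_congr rfl fun y _ => hE y, ← Finset.sum_filter,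
    Finset.sum_const, nsmul_eq_mul, mul_comm]

end Gram
end Gauss

lemma det_eq_mul_det_schur {R : Type*} [CommRing R] {k : ℕ}
    (D : Matrix (Fin (k + 1)) (Fin (k + 1)) R) (hp : D 0 0 * D 0 0 = 1) :
    D.det = D 0 0 * (Matrix.of fun i j : Fin k =>
      D i.succ j.succ - D i.succ 0 * D 0 0 * D 0 j.succ).det := by
  let B : Matrix (Fin (k + 1)) (Fin (k + 1)) R := Matrix.of fun i j =>
    D i j - (if i = 0 then 0 else D i 0 * D 0 0) * D 0 j
  have hB : D.det = B.det :=
    Matrix.det_eq_of_forall_row_eq_smul_add_const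
      (fun i => if i = 0 then 0 else D i 0 * D 0 0) 0 (by simp) (by intro i j; simp [B])
  have h0 : ∀ i : Fin k, B i.succ 0 = 0 := by
    intro i
    simp only [B, Matrix.of_apply, Fin.succ_ne_zero, if_false]
    linear_combination (-D i.succ 0) * hp
  rw [hB, Matrix.det_succ_column_zero, Fin.sum_univ_succ, Finset.sum_eq_zero]
  · simp only [Fin.val_zero, pow_zero, one_mul, add_zero]
    congr 1
    simp [B]
  · intro i _
    rw [h0]
    ring

/-- A matrix with entries `0, 1, -1` all of whose subdeterminants vanish modulo `2` exactly when
they vanish modulo `3` has determinant `0`, `1` or `-1`. -/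
lemma abs_det_le_one : ∀ {k : ℕ} (D : Matrix (Fin k) (Fin k) ℤ), (∀ i j, |D i j| ≤ 1) →
    (∀ (m : ℕ) (f g : Fin m → Fin k),
      (2 : ℤ) ∣ (D.submatrix f g).det ↔ (3 : ℤ) ∣ (D.submatrix f g).det) → |D.det| ≤ 1 := by
  intro k
  induction k with
  | zero => intro D _ _; simp
  | succ k ih =>
    intro D hD H
    by_cases hcol : ∀ i, D i 0 = 0
    · rw [Matrix.det_eq_zero_of_column_eq_zero 0 hcol]
      simp
    push Not at hcol
    obtain ⟨i₀, hi₀⟩ := hcol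
    let D' := D.submatrix (Equiv.swap 0 i₀) id
    have habs : |D.det| = |D'.det| := by
      have h : D'.det = _ := Matrix.det_permute (Equiv.swap 0 i₀) D
      rcases Int.units_eq_one_or (Equiv.Perm.sign (Equiv.swap 0 i₀)) with hs | hs <;>
        rw [h, hs] <;> simp
    have hp : D' 0 0 * D' 0 0 = 1 := by
      have h1 : D' 0 0 = D i₀ 0 := by simp [D']
      have h2 := abs_le.1 (hD i₀ 0)
      rw [h1]
      have : D i₀ 0 = 1 ∨ D i₀ 0 = -1 := by omega
      rcases this with h | h <;> rw [h] <;> norm_num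
    have hD' : ∀ i j, |D' i j| ≤ 1 := fun i j => hD _ _
    let S : Matrix (Fin k) (Fin k) ℤ := Matrix.of fun i j =>
      D' i.succ j.succ - D' i.succ 0 * D' 0 0 * D' 0 j.succ
    have hp' : D' 0 0 = 1 ∨ D' 0 0 = -1 := by
      rcases Int.eq_one_or_neg_one_of_mul_eq_one hp with h | h <;> simp [h]
    have hdvd : ∀ n a : ℤ, n ∣ D' 0 0 * a ↔ n ∣ a := by
      intro n a
      rcases hp' with h | h <;> rw [h] <;> simp
    have hsub : ∀ (m : ℕ) (f g : Fin m → Fin k),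
        ((D.submatrix (Equiv.swap 0 i₀ ∘ Fin.cons 0 (Fin.succ ∘ f))
          (Fin.cons 0 (Fin.succ ∘ g) : Fin (m + 1) → Fin (k + 1))).det : ℤ) =
          D' 0 0 * (S.submatrix f g).det := by
      intro m f g
      exact det_eq_mul_det_schur (D'.submatrix (Fin.cons 0 (Fin.succ ∘ f))
          (Fin.cons 0 (Fin.succ ∘ g) : Fin (m + 1) → Fin (k + 1))) hp
    have HS : ∀ (m : ℕ) (f g : Fin m → Fin k),
        (2 : ℤ) ∣ (S.submatrix f g).det ↔ (3 : ℤ) ∣ (S.submatrix f g).det := by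
      intro m f g
      rw [← hdvd 2, ← hdvd 3, ← hsub]
      exact H _ _ _
    have hS : ∀ i j, |S i j| ≤ 1 := by
      intro i j
      have h := HS 1 (fun _ => i) (fun _ => j)
      simp only [Matrix.det_unique, Matrix.submatrix_apply] at h
      have h1 := abs_le.1 (hD' i.succ j.succ)
      have h2 : |D' i.succ 0 * D' 0 0 * D' 0 j.succ| ≤ 1 := by
        rw [abs_mul, abs_mul]
        exact mul_le_one₀ (mul_le_one₀ (hD' _ _) (abs_nonneg _) (hD' _ _)) (abs_nonneg _)
          (hD' _ _)
      have h3 := abs_le.1 h2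
      have h4 : S i j = D' i.succ j.succ - D' i.succ 0 * D' 0 0 * D' 0 j.succ := rfl
      rw [abs_le]
      omega
    rw [habs, det_eq_mul_det_schur D' hp, abs_mul]
    exact mul_le_one₀ (hD' 0 0) (abs_nonneg _) (ih S hS HS)

section Representation

variable {𝕜 : Type} [Field 𝕜]

/-- The rank function of `M` is that of the family of vectors `v`. -/
def IsRealizedBy (M : Matroid E) (𝕜 : Type*) [Field 𝕜] {V : Type*} [AddCommGroup V]
    [Module 𝕜 V] (v : E → V) : Prop :=
  ∀ S : Finset E, M.r S = Module.finrank 𝕜 (Submodule.span 𝕜 (v '' S))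

lemma Representable.exists_isRealizedBy {M : Matroid E} (h : Representable M 𝕜) :
    ∃ (n : ℕ) (v : E → Fin n → 𝕜), IsRealizedBy M 𝕜 v := by
  obtain ⟨n, A, hA⟩ := h
  refine ⟨n, A.col, fun S => ?_⟩
  have : Set.range (A.submatrix id fun x : S => (x : E)).col = A.col '' S := by
    rw [Set.image_eq_range]
    rfl
  rw [hA S, Matrix.rank_eq_finrank_span_cols, this]

lemma exists_image_rank_eq {M : Matroid E} (h : Representable M 𝕜) {r : ℕ}
    (hr : M.r Finset.univ = r) :
    ∃ b : Fin r → E, M.r (Finset.univ.image b) = r := by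
  obtain ⟨n, v, hv⟩ := h.exists_isRealizedBy
  obtain ⟨f, hf, hspan, -⟩ :=
    Submodule.exists_fun_fin_finrank_span_eq 𝕜 (v '' (Finset.univ : Finset E))
  obtain rfl : r = Module.finrank 𝕜 (Submodule.span 𝕜 (v '' (Finset.univ : Finset E))) :=
    hr.symm.trans (hv _)
  choose b _ hb using hf
  refine ⟨b, ?_⟩
  have himg : v '' (Finset.univ.image b : Finset E) = Set.range f := by
    ext x
    simp [hb]
  rw [hv, himg]
  exact congrArg (fun p : Submodule 𝕜 (Fin n → 𝕜) => Module.finrank 𝕜 p) hspan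

lemma exists_standard {M : Matroid E} (h : Representable M 𝕜) {r : ℕ}
    (hr : M.r Finset.univ = r) {b : Fin r → E} (hb : M.r (Finset.univ.image b) = r) :
    ∃ N : Matrix (Fin r) E 𝕜,
      (∀ i j, N i (b j) = if i = j then 1 else 0) ∧ IsRealizedBy M 𝕜 N.col := by
  obtain ⟨n, v, hv⟩ := h.exists_isRealizedBy
  have himg : v '' (Finset.univ.image b : Finset E) = Set.range (v ∘ b) := by
    simp [Set.range_comp]
  have hspan : Submodule.span 𝕜 (Set.range (v ∘ b)) = Submodule.span 𝕜 (Set.range v) := by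
    apply Submodule.eq_of_le_of_finrank_eq (Submodule.span_mono (Set.range_comp_subset_range b v))
    rw [← himg, ← hv, hb, ← hr, hv, Finset.coe_univ, Set.image_univ]
  have hli : LinearIndependent 𝕜 (v ∘ b) := by
    rw [linearIndependent_iff_card_eq_finrank_span, Set.finrank, ← himg, ← hv, hb, Fintype.card_fin]
  let B := Module.Basis.span hli
  have hmem : ∀ e, v e ∈ Submodule.span 𝕜 (Set.range (v ∘ b)) := fun e => by
    rw [hspan]; exact Submodule.subset_span ⟨e, rfl⟩
  let N : Matrix (Fin r) E 𝕜 := Matrix.of fun i e => B.repr ⟨v e, hmem e⟩ i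
  let φ : (Fin r → 𝕜) →ₗ[𝕜] (Fin n → 𝕜) :=
    (Submodule.subtype _).comp B.equivFun.symm.toLinearMap
  have hφ : Function.Injective φ :=
    (Submodule.subtype_injective _).comp B.equivFun.symm.injective
  have hφN : ∀ e, φ (N.col e) = v e := by
    intro e
    have : N.col e = B.equivFun ⟨v e, hmem e⟩ := rfl
    simp [φ, this]
  refine ⟨N, fun i j => ?_, fun S => ?_⟩
  · have : (⟨v (b j), hmem (b j)⟩ : Submodule.span 𝕜 (Set.range (v ∘ b))) = B j := by
      ext1
      simp [B, Module.Basis.span_apply]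
    simp only [N, Matrix.of_apply, this, Module.Basis.repr_self, Finsupp.single_apply]
    simp [eq_comm]
  · rw [hv S, (Submodule.equivMapOfInjective φ hφ (Submodule.span 𝕜 (N.col '' S))).finrank_eq,
      Submodule.map_span, Set.image_image, funext hφN]

lemma det_submatrix_ne_zero_iff {M : Matroid E} {r : ℕ} {N : Matrix (Fin r) E 𝕜}
    (hN : IsRealizedBy M 𝕜 N.col) (c : Fin r → E) :
    (N.submatrix id c).det ≠ 0 ↔ M.r (Finset.univ.image c) = r := by
  rw [← isUnit_iff_ne_zero, ← Matrix.isUnit_iff_isUnit_det,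
    ← Matrix.linearIndependent_cols_iff_isUnit, linearIndependent_iff_card_eq_finrank_span,
    hN, Set.finrank, Fintype.card_fin, eq_comm]
  have : Set.range (N.submatrix id c).col = N.col '' (Finset.univ.image c : Finset E) := by
    simp only [Finset.coe_image, Finset.coe_univ, Set.image_univ, ← Set.range_comp]
    rfl
  rw [this]

/-- A square subdeterminant of a matrix containing an identity submatrix is, up to vanishing, a
maximal one. -/
lemma det_submatrix_eq_zero_iff_extend {E : Type*} {r m : ℕ} {N : Matrix (Fin r) E 𝕜} {b : Fin r → E}
    (hb : ∀ i j, N i (b j) = if i = j then 1 else 0) {f : Fin m → Fin r}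
    (hf : f.Injective) (g : Fin m → E) :
    (N.submatrix f g).det = 0 ↔ (N.submatrix id (Function.extend f g b)).det = 0 := by
  rw [← Matrix.exists_vecMul_eq_zero_iff, ← Matrix.exists_vecMul_eq_zero_iff]
  have hsum : ∀ y : Fin r → 𝕜, (∀ j, j ∉ Set.range f → y j = 0) → ∀ e,
      ∑ i, y i * N i e = ∑ i, y (f i) * N (f i) e := by
    intro y hy e
    rw [← Finset.sum_image (s := Finset.univ) (f := fun i => y i * N i e) (g := f)
      (fun _ _ _ _ h => hf h)]
    refine (Finset.sum_subset (Finset.subset_univ _) fun j _ hj => ?_).symm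
    rw [hy j (by simpa using hj), zero_mul]
  constructor
  · rintro ⟨v, hv, hv0⟩
    have h0 : ∀ j, j ∉ Set.range f → Function.extend f v 0 j = 0 := fun j hj => by
      rw [Function.extend_apply' _ _ _ (by simpa using hj)]; rfl
    refine ⟨Function.extend f v 0, fun h => hv ?_, ?_⟩
    · ext i
      rw [← hf.extend_apply v 0 i, h]
      rfl
    · ext j
      change ∑ i, Function.extend f v 0 i * N i (Function.extend f g b j) = 0
      by_cases hj : ∃ i, f i = j
      · obtain ⟨i, rfl⟩ := hj
        rw [hf.extend_apply, hsum _ h0]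
        simp only [hf.extend_apply]
        exact congrFun hv0 i
      · rw [Function.extend_apply' _ _ _ hj]
        simp [hb, h0 j (by simpa using hj)]
  · rintro ⟨y, hy, hy0⟩
    have h1 : ∀ j, ∑ i, y i * N i (Function.extend f g b j) = 0 := fun j => congrFun hy0 j
    have h0 : ∀ j, j ∉ Set.range f → y j = 0 := fun j hj => by
      have := h1 j
      rw [Function.extend_apply' _ _ _ (by simpa using hj)] at this
      simpa [hb] using this
    refine ⟨y ∘ f, fun h => hy ?_, ?_⟩
    · ext j
      by_cases hj : j ∈ Set.range f
      · obtain ⟨i, rfl⟩ := hj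
        exact congrFun h i
      · exact h0 j hj
    · ext i
      have := h1 (f i)
      rw [hf.extend_apply, hsum _ h0] at this
      exact this

end Representation

section Unimodular

lemma linearIndependent_comp_iff_det_ne_zero {𝕜 E : Type*} [Field 𝕜] {r : ℕ}
    (N : Matrix (Fin r) E 𝕜) (c : Fin r → E) :
    LinearIndependent 𝕜 (N.col ∘ c) ↔ (N.submatrix id c).det ≠ 0 := by
  rw [← isUnit_iff_ne_zero, ← Matrix.isUnit_iff_isUnit_det,
    ← Matrix.linearIndependent_cols_iff_isUnit]
  rfl

/-- If every maximal subdeterminant that is nonzero for `N` is nonzero for `N'`, then the ranks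
of column sets of `N` are at most those of `N'`. -/
lemma finrank_span_col_le {K L E : Type*} [Field K] [Field L] [Finite E] {r : ℕ}
    (N : Matrix (Fin r) E K) (N' : Matrix (Fin r) E L)
    (h : ∀ c : Fin r → E, (N.submatrix id c).det ≠ 0 → (N'.submatrix id c).det ≠ 0)
    {c₀ : Fin r → E} (hc₀ : (N.submatrix id c₀).det ≠ 0) (S : Set E) :
    Module.finrank K (Submodule.span K (N.col '' S)) ≤
      Module.finrank L (Submodule.span L (N'.col '' S)) := by
  classical
  cases nonempty_fintype E
  obtain ⟨b, hbS, -, hSb, hb⟩ := exists_linearIndepOn_extension (v := N.col) (t := S)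
    (linearIndepOn_empty K N.col) (Set.empty_subset _)
  obtain ⟨b', -, hbb', hb'span, hb'⟩ := exists_linearIndepOn_extension (t := Set.univ)
    hb (Set.subset_univ _)
  have htop : Submodule.span K (N.col '' b') = ⊤ := by
    rw [eq_top_iff, ← ((linearIndependent_comp_iff_det_ne_zero N c₀).2 hc₀).span_eq_top_of_card_eq_finrank' (by simp),
      Submodule.span_le]
    rintro _ ⟨i, rfl⟩
    exact hb'span ⟨c₀ i, trivial, rfl⟩
  have hcard : Fintype.card b' = r := by
    have := linearIndependent_iff_card_eq_finrank_span.1 hb'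
    rw [this, Set.finrank, ← Set.image_eq_range, htop, finrank_top]
    simp
  let c : Fin r ≃ b' := (Fintype.equivFinOfCardEq hcard).symm
  have hc : LinearIndependent K (N.col ∘ fun i => (c i : E)) :=
    (hb' : LinearIndependent K _).comp c c.injective
  have hc' : LinearIndependent L (N'.col ∘ fun i => (c i : E)) :=
    (linearIndependent_comp_iff_det_ne_zero _ _).2
      (h _ ((linearIndependent_comp_iff_det_ne_zero _ _).1 hc))
  have hb'' : LinearIndepOn L N'.col b' := by
    have := hc'.comp c.symm c.symm.injective
    have h2 : (N'.col ∘ fun i => (c i : E)) ∘ c.symm = fun x : b' => N'.col x := by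
      ext x
      simp
    rwa [h2] at this
  have e1 : Submodule.span K (N.col '' S) = Submodule.span K (N.col '' b) :=
    le_antisymm (Submodule.span_le.2 hSb) (Submodule.span_mono (Set.image_mono hbS))
  have e2 : Module.finrank K (Submodule.span K (N.col '' b)) = Fintype.card b := by
    rw [Set.image_eq_range]
    exact finrank_span_eq_card hb
  have e3 : Module.finrank L (Submodule.span L (N'.col '' b)) = Fintype.card b := by
    rw [Set.image_eq_range]
    exact finrank_span_eq_card (hb''.mono hbb')
  rw [e1, e2, ← e3]
  exact Submodule.finrank_mono (Submodule.span_mono (Set.image_mono hbS))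

lemma det_map_intCast_submatrix {R ι E : Type*} [CommRing R] {m : ℕ} (Z : Matrix ι E ℤ)
    (f : Fin m → ι) (g : Fin m → E) :
    ((Z.map (Int.cast : ℤ → R)).submatrix f g).det = ((Z.submatrix f g).det : R) :=
  ((Int.castRingHom R).map_det (Z.submatrix f g)).symm

lemma abs_det_submatrix_le_one {E : Type} [Fintype E] [DecidableEq E] {M : Matroid E}
    {r : ℕ} {N₂ : Matrix (Fin r) E (ZMod 2)} {N₃ : Matrix (Fin r) E (ZMod 3)} {b : Fin r → E}
    (h₂ : IsRealizedBy M (ZMod 2) N₂.col) (h₃ : IsRealizedBy M (ZMod 3) N₃.col)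
    (hb₂ : ∀ i j, N₂ i (b j) = if i = j then 1 else 0)
    (hb₃ : ∀ i j, N₃ i (b j) = if i = j then 1 else 0) (c : Fin r → E) :
    |((N₃.map fun x => x.valMinAbs).submatrix id c).det| ≤ 1 := by
  have hiff : ∀ (m : ℕ) (f : Fin m → Fin r) (g : Fin m → E),
      (N₂.submatrix f g).det = 0 ↔ (N₃.submatrix f g).det = 0 := by
    intro m f g
    by_cases hf : f.Injective
    · rw [det_submatrix_eq_zero_iff_extend hb₂ hf, det_submatrix_eq_zero_iff_extend hb₃ hf,
        ← not_iff_not, ← ne_eq, ← ne_eq, det_submatrix_ne_zero_iff h₂,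
        det_submatrix_ne_zero_iff h₃]
    · simp only [Function.Injective, not_forall] at hf
      obtain ⟨i, j, hij, hne⟩ := hf
      rw [Matrix.det_zero_of_row_eq hne (by ext; simp [hij]),
        Matrix.det_zero_of_row_eq hne (by ext; simp [hij])]
      simp
  have hN₃ : (N₃.map fun x => x.valMinAbs).map (Int.cast : ℤ → ZMod 3) = N₃ := by
    ext i e
    simp
  have hN₂ : (N₃.map fun x => x.valMinAbs).map (Int.cast : ℤ → ZMod 2) = N₂ := by
    ext i e
    have h := hiff 1 (fun _ => i) (fun _ => e)
    simp only [Matrix.det_unique, Matrix.submatrix_apply] at h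
    simp only [Matrix.map_apply]
    generalize N₂ i e = x at h
    generalize N₃ i e = y at h
    revert h x y
    decide
  have key : ∀ (n : ℕ) [NeZero n] (m : ℕ) (f : Fin m → Fin r) (g : Fin m → E),
      (n : ℤ) ∣ ((N₃.map fun x => x.valMinAbs).submatrix f g).det ↔
        (((N₃.map fun x => x.valMinAbs).map (Int.cast : ℤ → ZMod n)).submatrix f g).det = 0 := by
    intro n _ m f g
    rw [← ZMod.intCast_zmod_eq_zero_iff_dvd, det_map_intCast_submatrix]
  refine abs_det_le_one _ (fun i j => ?_) fun m f g => ?_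
  · simp only [Matrix.submatrix_apply, Matrix.map_apply]
    generalize N₃ _ _ = y
    revert y
    decide
  · have k₂ := key 2 m f (c ∘ g)
    have k₃ := key 3 m f (c ∘ g)
    rw [hN₂] at k₂
    rw [hN₃] at k₃
    exact k₂.trans ((hiff m f _).trans k₃.symm)

/-- A regular matroid has a totally unimodular representation. -/
lemma Regular.exists_unimodular {E : Type} [Fintype E] [DecidableEq E] {M : Matroid E}
    (hM : Regular M) {r : ℕ} (hr : M.r Finset.univ = r) (F : Type*) [Field F] :
    ∃ N : Matrix (Fin r) E F, IsRealizedBy M F N.col ∧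
      ∀ c : Fin r → E,
        (N.submatrix id c).det ^ 2 = if M.r (Finset.univ.image c) = r then 1 else 0 := by
  obtain ⟨b, hb⟩ := exists_image_rank_eq (hM ℚ) hr
  obtain ⟨N₂, hb₂, h₂⟩ := exists_standard (hM (ZMod 2)) hr hb
  obtain ⟨N₃, hb₃, h₃⟩ := exists_standard (hM (ZMod 3)) hr hb
  have habs := abs_det_submatrix_le_one h₂ h₃ hb₂ hb₃
  set Z : Matrix (Fin r) E ℤ := N₃.map fun x => x.valMinAbs with hZ
  have hZ₃ : Z.map (Int.cast : ℤ → ZMod 3) = N₃ := by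
    ext i e
    simp [hZ]
  have hcast₃ : ∀ c : Fin r → E, (N₃.submatrix id c).det = ((Z.submatrix id c).det : ZMod 3) := by
    intro c
    rw [← hZ₃, det_map_intCast_submatrix]
  have hdet : ∀ c : Fin r → E,
      (Z.submatrix id c).det ^ 2 = if M.r (Finset.univ.image c) = r then 1 else 0 := by
    intro c
    have h1 := det_submatrix_ne_zero_iff h₃ c
    have h2 := abs_le.1 (habs c)
    rw [hcast₃] at h1
    have h3 : (Z.submatrix id c).det = -1 ∨ (Z.submatrix id c).det = 0 ∨
      (Z.submatrix id c).det = 1 := by omega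
    rcases h3 with h | h | h
    · rw [h] at h1 ⊢
      rw [if_pos (h1.1 (by decide))]; norm_num
    · rw [h] at h1 ⊢
      rw [if_neg (fun h' => h1.2 h' (by decide))]; norm_num
    · rw [h] at h1 ⊢
      rw [if_pos (h1.1 (by decide))]; norm_num
  have hdetF : ∀ c : Fin r → E, ((Z.map (Int.cast : ℤ → F)).submatrix id c).det ^ 2 =
      if M.r (Finset.univ.image c) = r then 1 else 0 := by
    intro c
    rw [det_map_intCast_submatrix, ← Int.cast_pow, hdet]
    split_ifs <;> simp
  have hiff : ∀ c : Fin r → E, ((Z.map (Int.cast : ℤ → F)).submatrix id c).det ≠ 0 ↔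
      (N₃.submatrix id c).det ≠ 0 := by
    intro c
    rw [det_submatrix_ne_zero_iff h₃, ← pow_ne_zero_iff two_ne_zero, hdetF]
    split_ifs with h <;> simp [h]
  refine ⟨Z.map Int.cast, fun S => ?_, hdetF⟩
  have hb0 := (det_submatrix_ne_zero_iff h₃ b).2 hb
  rw [h₃]
  exact le_antisymm (finrank_span_col_le _ _ (fun c => (hiff c).2) hb0 _)
    (finrank_span_col_le _ _ (fun c => (hiff c).1) ((hiff b).2 hb0) _)

end Unimodular

section Counting

variable {F : Type*} [Field F] [Fintype F] [DecidableEq F]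

lemma card_vecMul_eq_zero {M : Matroid E} {r : ℕ} {N : Matrix (Fin r) E F}
    (hN : IsRealizedBy M F N.col) (S : Finset E) :
    (Finset.univ.filter fun y : Fin r → F => ∀ e ∈ S, Matrix.vecMul y N e = 0).card =
      Fintype.card F ^ (r - M.r S) := by
  let A : Matrix S (Fin r) F := (N.submatrix id fun x : S => (x : E)).transpose
  have hrank : A.rank = M.r S := by
    rw [Matrix.rank_transpose, Matrix.rank_eq_finrank_span_cols, hN, Set.image_eq_range]
    rfl
  have hker : Module.finrank F (LinearMap.ker A.mulVecLin) = r - M.r S := by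
    have := LinearMap.finrank_range_add_finrank_ker A.mulVecLin
    rw [← hrank, Matrix.rank]
    simp only [Module.finrank_fin_fun] at this
    omega
  rw [← hker, ← Nat.card_eq_fintype_card, ← Module.natCard_eq_pow_finrank]
  refine (Nat.subtype_card _ fun y => ?_).symm
  simp only [Finset.mem_filter, Finset.mem_univ, true_and, LinearMap.mem_ker,
    Matrix.mulVecLin_apply, funext_iff, Pi.zero_apply, Subtype.forall, A, Matrix.mulVec_transpose]
  rfl

lemma charPolyVal_eq_card {M : Matroid E} {r : ℕ} (hr : M.r Finset.univ = r)
    {N : Matrix (Fin r) E F} (hN : IsRealizedBy M F N.col) :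
    charPolyVal M.r (Fintype.card F) =
      (Finset.univ.filter fun y : Fin r → F => ∀ e, Matrix.vecMul y N e ≠ 0).card := by
  have h := Finset.inclusion_exclusion_card_inf_compl (Finset.univ : Finset E)
    fun e => Finset.univ.filter fun y : Fin r → F => Matrix.vecMul y N e = 0
  have h1 : (Finset.univ.filter fun y : Fin r → F => ∀ e, Matrix.vecMul y N e ≠ 0) =
      Finset.univ.inf fun e : E =>
        (Finset.univ.filter fun y : Fin r → F => Matrix.vecMul y N e = 0)ᶜ := by
    ext y
    simp [Finset.mem_inf]
  have h2 : ∀ S : Finset E, (S.inf fun e : E =>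
        (Finset.univ.filter fun y : Fin r → F => Matrix.vecMul y N e = 0)) =
      Finset.univ.filter fun y : Fin r → F => ∀ e ∈ S, Matrix.vecMul y N e = 0 := by
    intro S
    ext y
    simp [Finset.mem_inf]
  rw [← h1] at h
  rw [← Int.cast_natCast (Finset.card _), h, charPolyVal]
  simp only [h2, card_vecMul_eq_zero hN, Finset.powerset_univ, hr]
  push_cast
  rfl

end Counting

section Sbar

variable {F : Type} [Field F]

lemma rank_le_univ (M : Matroid E) (A : Finset E) : M.r A ≤ M.r Finset.univ :=
  M.r_mono (Finset.subset_univ A)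

/-- If `A` does not have full rank then some element increases its rank. -/
lemma exists_rank_insert (M : Matroid E) {A : Finset E} (hA : M.r A ≠ M.r Finset.univ) :
    ∃ e, M.r (insert e A) ≠ M.r A := by
  by_contra! h
  apply hA
  suffices ∀ B : Finset E, M.r (A ∪ B) = M.r A by
    rw [← this Finset.univ, Finset.union_eq_right.2 (Finset.subset_univ A)]
  intro B
  induction B using Finset.induction_on with
  | empty => simp
  | insert e B _ ih =>
    have h1 := M.r_submod (A ∪ B) (insert e A)
    have h2 := M.r_mono (show A ⊆ (A ∪ B) ∩ insert e A by grind)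
    have h3 := M.r_mono (show A ⊆ A ∪ insert e B by grind)
    have h4 : A ∪ B ∪ insert e A = A ∪ insert e B := by grind
    rw [h4] at h1
    have := h e
    omega

lemma rank_insert_le (M : Matroid E) (A : Finset E) (e : E) :
    M.r (insert e A) ≤ M.r A + 1 := by
  have h1 := M.r_submod A {e}
  have h2 := M.r_le_card {e}
  have h3 : A ∪ {e} = insert e A := by grind
  rw [Finset.card_singleton] at h2
  rw [h3] at h1
  omega

/-- Adding a coloop to a restriction does not change `sbar`. -/
lemma sbar_insert_of_rank_ne (M : Matroid E) {A : Finset E} {e : E}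
    (he : M.r (insert e A) ≠ M.r A) (α : E → F) : sbar M (insert e A) α = sbar M A α := by
  have heA : e ∉ A := fun h => he (by rw [Finset.insert_eq_of_mem h])
  have hle := M.r_mono (Finset.subset_insert e A)
  have hge := rank_insert_le M A e
  have hrA : M.r (insert e A) = M.r A + 1 := by omega
  symm
  unfold sbar
  refine Finset.sum_nbij' (insert e) (fun B => B.erase e) ?_ ?_ ?_ ?_ ?_
  · intro B hB
    simp only [restrBases, Finset.mem_filter, Finset.mem_powerset] at hB ⊢
    obtain ⟨hBA, hBc, hBr⟩ := hB
    have heB : e ∉ B := fun h => heA (hBA h)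
    have h1 := M.r_submod (insert e B) A
    have h2 : insert e B ∪ A = insert e A := by grind
    have h3 : insert e B ∩ A = B := by grind
    have h4 := rank_insert_le M B e
    rw [h2, h3] at h1
    rw [Finset.card_insert_of_notMem heB]
    exact ⟨Finset.insert_subset_insert _ hBA, by omega, by omega⟩
  · intro B hB
    simp only [restrBases, Finset.mem_filter, Finset.mem_powerset] at hB ⊢
    obtain ⟨hBA, hBc, hBr⟩ := hB
    have heB : e ∈ B := by
      by_contra heB
      have := M.r_mono (show B ⊆ A by grind)
      omega
    have hsub : B.erase e ⊆ A := by grind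
    have h1 := M.r_mono hsub
    have h2 := rank_insert_le M (B.erase e) e
    rw [Finset.insert_erase heB] at h2
    have h3 := M.r_le_card (B.erase e)
    rw [Finset.card_erase_of_mem heB] at h3 ⊢
    exact ⟨hsub, by omega, by omega⟩
  · intro B hB
    simp only [restrBases, Finset.mem_filter, Finset.mem_powerset] at hB
    exact Finset.erase_insert fun h => heA (hB.1 h)
  · intro B hB
    simp only [restrBases, Finset.mem_filter, Finset.mem_powerset] at hB
    apply Finset.insert_erase
    by_contra heB
    have := M.r_mono (show B ⊆ A by grind)
    omega
  · intro B hB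
    congr 1
    grind

/-- A set of maximum cardinality with nonvanishing `sbar` has full rank. -/
lemma rank_eq_of_sbar_maximal (M : Matroid E) {α : E → F} {A : Finset E}
    (hA : sbar M A α ≠ 0) (hmax : ∀ A', sbar M A' α ≠ 0 → A'.card ≤ A.card) :
    M.r A = M.r Finset.univ := by
  by_contra h
  obtain ⟨e, he⟩ := exists_rank_insert M h
  have heA : e ∉ A := fun h => he (by rw [Finset.insert_eq_of_mem h])
  have := hmax (insert e A) (by rwa [sbar_insert_of_rank_ne M he])
  rw [Finset.card_insert_of_notMem heA] at this
  omega

lemma sbar_smul (M : Matroid E) (A : Finset E) (c : F) (α : E → F) :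
    sbar M A (c • α) = c ^ (A.card - M.r A) * sbar M A α := by
  unfold sbar
  rw [Finset.mul_sum]
  refine Finset.sum_congr rfl fun B hB => ?_
  simp only [restrBases, Finset.mem_filter, Finset.mem_powerset] at hB
  simp only [Pi.smul_apply, smul_eq_mul, Finset.prod_mul_distrib, Finset.prod_const,
    Finset.card_sdiff_of_subset hB.1]
  rw [← hB.2.2, hB.2.1]

lemma det_gram {M : Matroid E} {r : ℕ} {N : Matrix (Fin r) E F}
    (hN : ∀ c : Fin r → E,
      (N.submatrix id c).det ^ 2 = if M.r (Finset.univ.image c) = r then 1 else 0)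
    (A : Finset E) (α : E → F) :
    (gram N A α).det = ∑ B ∈ A.powerset.filter fun B => M.r B = B.card ∧ M.r B = r,
      ∏ e ∈ B, (α e)⁻¹ := by
  have h1 : gram N A α =
      N * Matrix.diagonal (fun e => if e ∈ A then (α e)⁻¹ else 0) * N.transpose := by
    ext i j
    rw [gram_apply, Matrix.mul_apply, ← Finset.sum_subset (Finset.subset_univ A)]
    · refine Finset.sum_congr rfl fun e he => ?_
      simp only [Matrix.mul_diagonal, Matrix.transpose_apply, he, if_true]
      ring
    · intro e _ he
      simp [Matrix.mul_diagonal, he]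
  rw [h1, det_mul_diagonal_mul_transpose_of_sq N _ (fun B => M.r B = r) fun c _ => hN c]
  symm
  refine Finset.sum_subset_zero_on_sdiff ?_ ?_ ?_
  · intro B hB
    simp only [Finset.mem_filter, Finset.mem_powerset, Finset.mem_powersetCard] at hB ⊢
    exact ⟨⟨Finset.subset_univ _, by omega⟩, hB.2.2⟩
  · intro B hB
    simp only [Finset.mem_sdiff, Finset.mem_filter, Finset.mem_powerset,
      Finset.mem_powersetCard] at hB
    have : ¬ B ⊆ A := fun h => hB.2 ⟨h, by omega, hB.1.2⟩
    obtain ⟨e, heB, heA⟩ := Finset.not_subset.1 this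
    exact Finset.prod_eq_zero heB (by simp [heA])
  · intro B hB
    simp only [Finset.mem_filter, Finset.mem_powerset] at hB
    exact Finset.prod_congr rfl fun e he => by simp [hB.1 he]

lemma sbar_eq_prod_mul_det_gram {M : Matroid E} {r : ℕ}
    {N : Matrix (Fin r) E F}
    (hN : ∀ c : Fin r → E,
      (N.submatrix id c).det ^ 2 = if M.r (Finset.univ.image c) = r then 1 else 0)
    {A : Finset E} (hA : M.r A = r) {α : E → F} (hα : ∀ e, α e ≠ 0) :
    sbar M A α = (∏ e ∈ A, α e) * (gram N A α).det := by
  rw [det_gram hN, sbar, restrBases, hA, Finset.mul_sum]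
  refine Finset.sum_congr rfl fun B hB => ?_
  simp only [Finset.mem_filter, Finset.mem_powerset] at hB
  rw [← Finset.prod_sdiff hB.1, mul_assoc, ← Finset.prod_mul_distrib]
  simp [hα]

lemma rank_eq_of_det_gram_ne_zero {M : Matroid E} {r : ℕ} (hr : M.r Finset.univ = r)
    {N : Matrix (Fin r) E F}
    (hN : ∀ c : Fin r → E,
      (N.submatrix id c).det ^ 2 = if M.r (Finset.univ.image c) = r then 1 else 0)
    {A : Finset E} {α : E → F} (h : (gram N A α).det ≠ 0) : M.r A = r := by
  rw [det_gram hN] at h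
  obtain ⟨B, hB, -⟩ := Finset.exists_ne_zero_of_sum_ne_zero h
  simp only [Finset.mem_filter, Finset.mem_powerset] at hB
  have := M.r_mono hB.1
  have := rank_le_univ M A
  omega

end Sbar

section Assembly

variable {F : Type} [Field F] [Fintype F] [DecidableEq F] {K : Type*} [Field K] [CharZero K]
  {ψ : AddChar F K} {M : Matroid E} {r : ℕ} {N : Matrix (Fin r) E F}

lemma quadCharTo_mul_formGauss_mul_pow (hF : ringChar F ≠ 2) (hψ : ψ.IsPrimitive)
    (hr : M.r Finset.univ = r)
    (hN : ∀ c : Fin r → E,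
      (N.submatrix id c).det ^ 2 = if M.r (Finset.univ.image c) = r then 1 else 0)
    {α : E → F} (hα : ∀ e, α e ≠ 0) {A : Finset E} (hA : sbar M A α ≠ 0)
    (hmax : ∀ A', sbar M A' α ≠ 0 → A'.card ≤ A.card) :
    quadCharTo F K (∏ e, α e) * formGauss ψ (gram N Finset.univ α) *
        quadGauss ψ ^ (A.card - r) =
      quadGauss ψ ^ Fintype.card E * quadCharTo F K (sbar M A α) := by
  have hrA : M.r A = r := (rank_eq_of_sbar_maximal M hA hmax).trans hr
  have hs := sbar_eq_prod_mul_det_gram hN hrA hα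
  have hdet : (gram N A α).det ≠ 0 := fun h => hA (by rw [hs, h, mul_zero])
  rw [formGauss_gram hF hψ N hα hdet fun A' hA' => hmax A' ?_, hs, mul_right_comm, ← pow_add]
  · congr 2
    have h1 := Finset.card_add_card_compl A
    have h2 := M.r_le_card A
    omega
  · rw [sbar_eq_prod_mul_det_gram hN (rank_eq_of_det_gram_ne_zero hr hN hA') hα]
    exact mul_ne_zero (Finset.prod_ne_zero_iff.2 fun e _ => hα e) hA'

lemma quadGauss_pow_mul_g (hF : ringChar F ≠ 2) (hψ : ψ.IsPrimitive) {m : ℕ} (hm : Even m) :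
    quadGauss ψ ^ m * (g F m : K) = 1 := by
  obtain ⟨k, rfl⟩ := hm
  have h1 : quadCharTo F K (-1) * quadCharTo F K (-1) = 1 :=
    quadCharTo_mul_self (neg_ne_zero.2 one_ne_zero)
  have h2 : (Fintype.card F : K) ≠ 0 := by simp
  have h3 : (k + k) / 2 = k := by omega
  have h4 : quadCharTo F K (-1) = ((quadraticChar F (-1) : ℤ) : K) := quadCharTo_apply _
  rw [g, if_pos ⟨k, rfl⟩, h3, ← two_mul, pow_mul, quadGauss_sq hF hψ]
  push_cast
  rw [← h4, ← mul_pow, ← mul_pow, mul_mul_mul_comm, h1, mul_inv_cancel₀ h2]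
  simp

/-- The terms with odd exponent cancel, as seen by rescaling the weights by a nonsquare. -/
lemma sum_odd_eq_zero (hF : ringChar F ≠ 2) (hψ : ψ.IsPrimitive)
    (hr : M.r Finset.univ = r)
    (hN : ∀ c : Fin r → E,
      (N.submatrix id c).det ^ 2 = if M.r (Finset.univ.image c) = r then 1 else 0)
    {Astar : (E → F) → Finset E}
    (hne : ∀ α : E → F, (∀ e, α e ≠ 0) → sbar M (Astar α) α ≠ 0)
    (hmax : ∀ α : E → F, (∀ e, α e ≠ 0) →
      ∀ A : Finset E, sbar M A α ≠ 0 → A.card ≤ (Astar α).card) :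
    ∑ α ∈ (Finset.univ.filter fun α : E → F => ∀ e, α e ≠ 0) with
        ¬ Even ((Astar α).card - r),
      quadCharTo F K (∏ e, α e) * formGauss ψ (gram N Finset.univ α) = 0 := by
  obtain ⟨c, hc⟩ := quadraticChar_exists_neg_one hF
  have hc0 : c ≠ 0 := by
    rintro rfl
    simp at hc
  have hcK : quadCharTo F K c = -1 := by
    rw [quadCharTo_apply, hc]
    simp
  have hsmul : ∀ α : E → F, (∀ e, α e ≠ 0) → ∀ e, (c • α) e ≠ 0 := fun α hα e =>
    mul_ne_zero hc0 (hα e)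
  have hiff : ∀ (A : Finset E) (α : E → F), sbar M A (c • α) ≠ 0 ↔ sbar M A α ≠ 0 := by
    intro A α
    rw [sbar_smul, mul_ne_zero_iff, and_iff_right (pow_ne_zero _ hc0)]
  have hcard : ∀ α : E → F, (∀ e, α e ≠ 0) → (Astar (c • α)).card = (Astar α).card := by
    intro α hα
    refine le_antisymm (hmax α hα _ ((hiff _ _).1 (hne _ (hsmul α hα)))) ?_
    exact hmax _ (hsmul α hα) _ ((hiff _ _).2 (hne α hα))
  have hneg : ∀ α : E → F, (∀ e, α e ≠ 0) → ¬ Even ((Astar α).card - r) →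
      quadCharTo F K (∏ e, (c • α) e) * formGauss ψ (gram N Finset.univ (c • α)) =
        -(quadCharTo F K (∏ e, α e) * formGauss ψ (gram N Finset.univ α)) := by
    intro α hα hodd
    have h1 := quadCharTo_mul_formGauss_mul_pow hF hψ hr hN hα (hne α hα) (hmax α hα)
    have h2 := quadCharTo_mul_formGauss_mul_pow hF hψ hr hN (hsmul α hα)
      ((hiff _ _).2 (hne α hα)) fun A' hA' => hmax α hα A' ((hiff _ _).1 hA')
    rw [sbar_smul, rank_eq_of_sbar_maximal M (hne α hα) (hmax α hα), hr, map_mul, map_pow, hcK,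
      (Nat.not_even_iff_odd.1 hodd).neg_one_pow] at h2
    refine mul_right_cancel₀ (pow_ne_zero ((Astar α).card - r) (quadGauss_ne_zero hF hψ)) ?_
    rw [h2]
    linear_combination h1
  set s := (Finset.univ.filter fun α : E → F => ∀ e, α e ≠ 0).filter fun α =>
    ¬ Even ((Astar α).card - r)
  have hs : ∀ α, α ∈ s ↔ (∀ e, α e ≠ 0) ∧ ¬ Even ((Astar α).card - r) := fun α => by simp [s]
  have hmem : ∀ α, α ∈ s → c • α ∈ s := by
    intro α h
    rw [hs] at h ⊢
    exact ⟨hsmul α h.1, by rw [hcard α h.1]; exact h.2⟩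
  have hinj : Set.InjOn (fun α : E → F => c • α) s := fun α _ β _ h => smul_right_injective _ hc0 h
  have himg : s.image (fun α => c • α) = s :=
    Finset.eq_of_subset_of_card_le (Finset.image_subset_iff.2 hmem)
      (Finset.card_image_of_injOn hinj).ge
  rw [← self_eq_neg, ← Finset.sum_neg_distrib]
  conv_lhs => rw [← himg, Finset.sum_image hinj]
  exact Finset.sum_congr rfl fun α h => hneg α ((hs α).1 h).1 ((hs α).1 h).2

end Assembly

/-- **Theorem 1.** Let `q = p^d`, `p` an odd prime, and let `M` be a regular matroid
without loops on `E`.  For each everywhere-nonzero `α : E → 𝔽_q` let `A*(α)` be any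
subset of maximal cardinality among the `A ⊆ E` with `s̄(M|A;α) ≠ 0`.  Then
`χ_M(q) = ∑_α g(q, |A*(α)| − r(E)) · η(s̄(M|A*(α);α))`. -/
theorem alpha_representation_charPoly
    (E : Type) [Fintype E] [DecidableEq E]
    (F : Type) [Field F] [Fintype F] [DecidableEq F]
    (p d : ℕ) (hp : p.Prime) (hpodd : Odd p) (hcard : Fintype.card F = p ^ d)
    (M : Matroid E)
    (hregular : Regular M)
    (hloopless : ∀ e : E, M.r {e} ≠ 0)
    (Astar : (E → F) → Finset E)
    (hAstar_ne : ∀ α : E → F, (∀ e, α e ≠ 0) → sbar M (Astar α) α ≠ 0)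
    (hAstar_max : ∀ α : E → F, (∀ e, α e ≠ 0) →
      ∀ A : Finset E, sbar M A α ≠ 0 → A.card ≤ (Astar α).card) :
    charPolyVal M.r (Fintype.card F) =
      ∑ α ∈ Finset.univ.filter (fun α : E → F => ∀ e, α e ≠ 0),
        g F ((Astar α).card - M.r Finset.univ) *
          ((quadraticChar F (sbar M (Astar α) α) : ℤ) : ℚ) := by
  obtain ⟨r, hr⟩ : ∃ r, M.r Finset.univ = r := ⟨_, rfl⟩
  have hF : ringChar F ≠ 2 := by
    rw [ne_eq, FiniteField.even_card_iff_char_two, ← Nat.even_iff, Nat.not_even_iff_odd, hcard]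
    exact hpodd.pow
  have hchar : ringChar ℚ ≠ ringChar F := by
    rw [ringChar.eq_zero]
    exact (CharP.ringChar_ne_zero_of_finite F).symm
  let P := AddChar.FiniteField.primitiveChar F ℚ hchar
  let K := CyclotomicField P.n ℚ
  have hψ : P.char.IsPrimitive := P.prim
  have hG : quadGauss P.char ≠ 0 := quadGauss_ne_zero hF hψ
  obtain ⟨N, hN, hdet⟩ := hregular.exists_unimodular hr F
  apply Rat.cast_injective (α := K)
  rw [charPolyVal_eq_card hr hN]
  refine mul_left_cancel₀ (pow_ne_zero (Fintype.card E) hG) ?_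
  rw [Rat.cast_natCast, quadGauss_pow_mul_card hF N,
    ← Finset.sum_filter_add_sum_filter_not _ (fun α => Even ((Astar α).card - r)),
    sum_odd_eq_zero hF hψ hr hdet hAstar_ne hAstar_max, add_zero, Finset.sum_filter,
    Rat.cast_sum, Finset.mul_sum, hr]
  refine Finset.sum_congr rfl fun α hα => ?_
  have hα' : ∀ e, α e ≠ 0 := (Finset.mem_filter.1 hα).2
  push_cast
  split_ifs with heven
  · have h1 := quadCharTo_mul_formGauss_mul_pow hF hψ hr hdet hα' (hAstar_ne α hα')
      (hAstar_max α hα')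
    have h2 := quadGauss_pow_mul_g hF hψ heven
    rw [← quadCharTo_apply]
    linear_combination (g F ((Astar α).card - r) : K) * h1 -
      (quadCharTo F K (∏ e, α e) * formGauss P.char (gram N Finset.univ α)) * h2
  · rw [g, if_neg heven]
    simp

end AlphaRepr
end

section
/- Let q = p^d with p an odd prime, let M be a regular matroid without loops on a finite ground set E, and let α ∈ (𝔽_q^*)^E. If A₁ and A₂ are both maximum-cardinality subsets of E among subsets A with s̄(M|A;α) ≠ 0, then η( s̄(M|A₁;α) ) = η( s̄(M|A₂;α) ). -/
/-!
STATEMENT 5: the value of the quadratic character `η(s̄(M|A;α))` does not depend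
on the choice of the maximum-cardinality subset `A` with `s̄(M|A;α) ≠ 0`.
-/

namespace AlphaRepr

variable {E : Type} [Fintype E] [DecidableEq E]

section Determinants

open Matrix

/-- The Schur complement of the entry `(i, j)` of `X`, where `ε` plays the role of the inverse of
`X i j`, on the same index types as `X`. -/
def pivot {m n R : Type*} [CommRing R] (X : Matrix m n R) (ε : R) (i : m) (j : n) :
    Matrix m n R :=
  of fun r c => X r c - ε * X r j * X i c

theorem det_submatrix_vecCons {m n R : Type*} [CommRing R] (X : Matrix m n R) {ε : R} {i : m}
    {j : n} (h : ε * X i j = 1) {k : ℕ} (f : Fin k → m) (g : Fin k → n) :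
    (X.submatrix (vecCons i f) (vecCons j g)).det =
      X i j * ((pivot X ε i j).submatrix f g).det := by
  let B : Matrix (Fin (k + 1)) (Fin (k + 1)) R :=
    of (vecCons (fun c => X i (vecCons j g c)) fun r c => pivot X ε i j (f r) (vecCons j g c))
  have hB : (X.submatrix (vecCons i f) (vecCons j g)).det = B.det := by
    refine det_eq_of_forall_row_eq_smul_add_const (vecCons 0 fun r => ε * X (f r) j) 0 rfl ?_
    intro r c
    refine Fin.cases ?_ (fun r => ?_) r <;> simp [B, pivot]
  rw [hB, det_succ_column_zero, Fin.sum_univ_succ, Finset.sum_eq_zero]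
  · have : B.submatrix (Fin.succAbove 0) Fin.succ = (pivot X ε i j).submatrix f g := by
      ext r c
      simp [B]
    rw [this]
    simp [B]
  · intro r _
    have : B r.succ 0 = 0 := by
      simp only [B, pivot, of_apply, cons_val_succ, cons_val_zero]
      linear_combination (-X (f r) j) * h
    simp [this]

/-- If the entries of an integer matrix lie in `{-1, 0, 1}` and its minors have the same zero
pattern modulo `2` and modulo `3`, then all its minors lie in `{-1, 0, 1}`. -/
theorem abs_det_submatrix_le_one_s5 {m n : Type*} (k : ℕ) (X : Matrix m n ℤ)
    (h1 : ∀ i j, |X i j| ≤ 1)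
    (h23 : ∀ (l : ℕ) (f : Fin l → m) (g : Fin l → n),
      3 ∣ (X.submatrix f g).det ↔ 2 ∣ (X.submatrix f g).det)
    (f : Fin k → m) (g : Fin k → n) : |(X.submatrix f g).det| ≤ 1 := by
  induction k generalizing X with
  | zero => simp
  | succ k ih =>
    by_cases h0 : ∀ s, X (f 0) (g s) = 0
    · rw [det_eq_zero_of_row_eq_zero 0 (by simpa using h0)]
      simp
    push Not at h0
    obtain ⟨s, hs⟩ := h0
    set ε := X (f 0) (g s) with hε
    have hεε : ε * ε = 1 := by
      have := h1 (f 0) (g s)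
      rw [← hε, abs_le] at this
      have : ε = 1 ∨ ε = -1 := by omega
      rcases this with h | h <;> simp [h]
    have habs : |ε| = 1 := by
      rcases mul_self_eq_one_iff.1 hεε with h | h <;> simp [h]
    have hpiv := fun (l : ℕ) (f' : Fin l → m) (g' : Fin l → n) =>
      det_submatrix_vecCons X (i := f 0) (j := g s) hεε f' g'
    have hdvd : ∀ x y : ℤ, x ∣ ε * y ↔ x ∣ y := fun x y => by
      rcases mul_self_eq_one_iff.1 hεε with h | h <;> simp [h]
    have h23' : ∀ (l : ℕ) (f' : Fin l → m) (g' : Fin l → n),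
        3 ∣ ((pivot X ε (f 0) (g s)).submatrix f' g').det ↔
          2 ∣ ((pivot X ε (f 0) (g s)).submatrix f' g').det := by
      intro l f' g'
      have := h23 _ (vecCons (f 0) f') (vecCons (g s) g')
      rwa [hpiv, ← hε, hdvd, hdvd] at this
    have h1' : ∀ i j, |pivot X ε (f 0) (g s) i j| ≤ 1 := by
      intro i j
      have h := h23' 1 ![i] ![j]
      have a1 := h1 i j
      have a2 : |ε * X i (g s) * X (f 0) j| ≤ 1 := by
        rw [abs_mul, abs_mul, habs, one_mul]
        exact mul_le_one₀ (h1 _ _) (abs_nonneg _) (h1 _ _)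
      simp only [det_unique, submatrix_apply, pivot, of_apply] at h ⊢
      simp only [Fin.default_eq_zero, cons_val_zero] at h
      rw [abs_le] at *
      omega
    have key := ih (pivot X ε (f 0) (g s)) h1' h23' (Fin.tail f)
      (Fin.tail (g ∘ Equiv.swap 0 s))
    have e1 : vecCons (f 0) (Fin.tail f) = f := Fin.cons_self_tail f
    have e2 : vecCons (g s) (Fin.tail (g ∘ Equiv.swap 0 s)) = g ∘ Equiv.swap 0 s := by
      have := Fin.cons_self_tail (g ∘ Equiv.swap 0 s)
      simp only [Function.comp_apply, Equiv.swap_apply_left] at this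
      exact this
    have h2 := hpiv _ (Fin.tail f) (Fin.tail (g ∘ Equiv.swap 0 s))
    rw [e1, e2] at h2
    have h3 := det_permute' (Equiv.swap 0 s) (X.submatrix f g)
    rw [submatrix_submatrix, Function.comp_id] at h3
    have h4 : |(X.submatrix f (g ∘ Equiv.swap 0 s)).det| = |(X.submatrix f g).det| := by
      rw [h3, abs_mul]
      rcases Int.units_eq_one_or (Equiv.Perm.sign (Equiv.swap 0 s)) with h | h <;> simp [h]
    rw [← h4, h2, abs_mul, ← hε, habs, one_mul]
    exact key

end Determinants

section CauchyBinet

open Matrix Finset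

/-- The Cauchy–Binet expansion of `det (U * diagonal w * Uᵀ)` for a matrix `U` whose maximal
minors have square `1` on the index sets in `P` and vanish elsewhere. -/
theorem det_mul_diagonal_mul_transpose_s5 {m n R : Type*} [Fintype m] [DecidableEq m] [Fintype n]
    [DecidableEq n] [CommRing R] [IsDomain R] (U : Matrix m n R) (w : n → R)
    (P : Finset n → Prop) [DecidablePred P] (hcard : ∀ S, P S → S.card = Fintype.card m)
    (hU : ∀ h : m → n, (U.submatrix id h).det ^ 2 = if P (univ.image h) then 1 else 0) :
    (U * diagonal w * Uᵀ).det = ∑ S with P S, ∏ e ∈ S, w e := by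
  have expand : (U * diagonal w * Uᵀ).det =
      ∑ h : m → n, (∏ i, w (h i) * U i (h i)) * (U.submatrix id h).det := by
    have h1 : (U * diagonal w * Uᵀ)ᵀ = fun i => ∑ e, (w e * U i e) • Uᵀ e := by
      ext i j
      rw [transpose_apply, mul_apply, Finset.sum_apply]
      simp only [transpose_apply, mul_diagonal, Pi.smul_apply, smul_eq_mul]
      exact sum_congr rfl fun e _ => by ring
    have h2 := (detRowAlternating (n := m) (R := R)).toMultilinearMap.map_sum
      (fun (i : m) (e : n) => (w e * U i e) • Uᵀ e)
    rw [← det_transpose, h1]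
    refine h2.trans (sum_congr rfl fun h _ => ?_)
    rw [MultilinearMap.map_smul_univ, ← det_transpose (U.submatrix id h)]
    rfl
  rw [expand, ← sum_fiberwise univ (fun h : m → n => univ.image h), sum_filter]
  refine sum_congr rfl fun S _ => ?_
  split_ifs with hS
  · obtain ⟨σ⟩ : Nonempty (m ≃ S) := by
      rw [← Fintype.card_eq, Fintype.card_coe, hcard S hS]
    have himg : ∀ τ : m ≃ S, univ.image (fun i => (τ i : n)) = S := fun τ => by
      ext x
      simp only [mem_image, mem_univ, true_and]
      exact ⟨by rintro ⟨i, rfl⟩; exact (τ i).2, fun hx => ⟨τ.symm ⟨x, hx⟩, by simp⟩⟩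
    have hsq := hU fun i => (σ i : n)
    rw [himg σ, if_pos hS] at hsq
    have hbij : ∑ h : m → n with univ.image h = S,
        (∏ i, w (h i) * U i (h i)) * (U.submatrix id h).det =
        ∑ τ : Equiv.Perm m, (∏ i, w (σ (τ i)) * U i (σ (τ i))) *
          (U.submatrix id fun i => (σ (τ i) : n)).det := by
      symm
      refine sum_bij (fun τ _ i => (σ (τ i) : n)) ?_ ?_ ?_ ?_
      · intro τ _
        simp only [mem_filter, mem_univ, true_and]
        exact himg (τ.trans σ)
      · intro τ _ τ' _ h
        ext i
        exact σ.injective (Subtype.ext (congrFun h i))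
      · intro h hh
        simp only [mem_filter, mem_univ, true_and] at hh
        have hmem : ∀ i, h i ∈ S := fun i => hh ▸ mem_image_of_mem h (mem_univ i)
        let h' : m → m := fun i => σ.symm ⟨h i, hmem i⟩
        have hsurj : Function.Surjective h' := by
          intro j
          have : (σ j : n) ∈ univ.image h := hh ▸ (σ j).2
          obtain ⟨i, -, hi⟩ := mem_image.1 this
          exact ⟨i, by simp [h', hi]⟩
        have hbij : Function.Bijective h' := ⟨Finite.injective_iff_surjective.2 hsurj, hsurj⟩
        refine ⟨Equiv.ofBijective h' hbij, mem_univ _, funext fun i => ?_⟩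
        rw [Equiv.ofBijective_apply]
        simp [h']
      · intro τ _
        rfl
    have hw : ∀ τ : Equiv.Perm m, ∏ i, w (σ (τ i)) = ∏ e ∈ S, w e := fun τ => by
      rw [← prod_coe_sort S w]
      exact Fintype.prod_equiv (τ.trans σ) _ _ fun i => rfl
    have hdet : ∀ τ : Equiv.Perm m, (U.submatrix id fun i => (σ (τ i) : n)).det =
        Equiv.Perm.sign τ * (U.submatrix id fun i => (σ i : n)).det := fun τ =>
      det_permute' τ (U.submatrix id fun i => (σ i : n))
    have hdet' : (U.submatrix id fun i => (σ i : n)).det =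
        ∑ τ : Equiv.Perm m, (Equiv.Perm.sign τ : R) * ∏ i, U i (σ (τ i)) := by
      rw [← det_transpose, det_apply']
      rfl
    rw [hbij]
    simp_rw [prod_mul_distrib, hw, hdet]
    calc _ = (∏ e ∈ S, w e) * ((U.submatrix id fun i => (σ i : n)).det *
        ∑ τ : Equiv.Perm m, (Equiv.Perm.sign τ : R) * ∏ i, U i (σ (τ i))) := by
          rw [mul_sum, mul_sum]
          exact sum_congr rfl fun τ _ => by ring
      _ = _ := by rw [← hdet', ← sq, hsq, mul_one]
  · refine sum_eq_zero fun h hh => ?_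
    have := hU h
    rw [(mem_filter.1 hh).2, if_neg hS] at this
    rw [pow_eq_zero_iff two_ne_zero |>.1 this, mul_zero]

end CauchyBinet

section TotallyUnimodular

open Matrix Finset

/-- The rank of a family of columns of a representing matrix. -/
theorem rank_submatrix_eq_r {M : Matroid E} {K : Type} [Field K] {n : ℕ} {N : Matrix (Fin n) E K}
    (hN : ∀ S : Finset E, M.r S = (N.submatrix id (fun x : S => (x : E))).rank)
    {ι : Type*} [Fintype ι] (h : ι → E) : (N.submatrix id h).rank = M.r (univ.image h) := by
  rw [hN, rank_eq_finrank_span_cols, rank_eq_finrank_span_cols]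
  have : Set.range (N.submatrix id h).col =
      Set.range (N.submatrix id (fun x : univ.image h => (x : E))).col := by
    ext v
    constructor
    · rintro ⟨i, rfl⟩
      exact ⟨⟨h i, mem_image_of_mem h (mem_univ i)⟩, rfl⟩
    · rintro ⟨⟨x, hx⟩, rfl⟩
      obtain ⟨i, -, rfl⟩ := mem_image.1 hx
      exact ⟨i, rfl⟩
  rw [this]

/-- A representation in standard form with respect to a basis `B`. -/
theorem exists_standard_representation {M : Matroid E} {K : Type} [Field K]
    (hM : Representable M K) {B : Finset E} (hB : M.r B = B.card) (hBE : M.r B = M.r univ) :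
    ∃ Z : Matrix B E K, (∀ b b' : B, Z b b' = if b = b' then 1 else 0) ∧
      ∀ h : B → E, (Z.submatrix id h).det ≠ 0 ↔ M.r (univ.image h) = M.r univ := by
  obtain ⟨n, N, hN⟩ := hM
  set V := N.submatrix id (fun b : B => (b : E)) with hV
  have hVr : V.rank = B.card := by rw [← hB, hN]
  have hli : LinearIndependent K V.col := by
    rw [linearIndependent_iff_card_eq_finrank_span, Set.finrank, ← rank_eq_finrank_span_cols, hVr,
      Fintype.card_coe]
  have hspan : Submodule.span K (Set.range V.col) = Submodule.span K (Set.range N.col) := by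
    apply Submodule.eq_of_le_of_finrank_eq
    · apply Submodule.span_mono
      rintro _ ⟨b, rfl⟩
      exact ⟨b, rfl⟩
    · have h1 := rank_submatrix_eq_r hN (id : E → E)
      rw [submatrix_id_id, image_id] at h1
      rw [← rank_eq_finrank_span_cols, ← rank_eq_finrank_span_cols, h1, hVr, ← hB, hBE]
  have hex : ∀ e, ∃ z : B → K, ∑ b, z b • V.col b = N.col e := fun e => by
    rw [← Submodule.mem_span_range_iff_exists_fun, hspan]
    exact Submodule.subset_span ⟨e, rfl⟩
  choose z hz using hex
  have hmul : ∀ h : B → E, N.submatrix id h = V * (of fun b e => z e b).submatrix id h := by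
    intro h
    ext i j
    have := congrFun (hz (h j)) i
    rw [Finset.sum_apply] at this
    simp only [Pi.smul_apply, col_apply, smul_eq_mul] at this
    rw [submatrix_apply, id, ← this, mul_apply]
    exact sum_congr rfl fun b _ => mul_comm _ _
  refine ⟨of fun b e => z e b, ?_, ?_⟩
  · intro b b'
    have h1 : ∑ b, z b' b • V.col b = ∑ b, (if b = b' then (1 : K) else 0) • V.col b := by
      rw [hz]
      simp [hV]
      rfl
    exact Fintype.linearIndependent_iffₛ.1 hli _ _ h1 b
  · intro h
    have h1 := rank_submatrix_eq_r hN h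
    rw [hmul] at h1
    rw [← h1, ← hBE, hB]
    constructor
    · intro hd
      rw [rank_mul_eq_left_of_det_ne_zero _ _ hd, hVr]
    · intro hr hd
      have h2 := rank_mul_le_right V ((of fun b e => z e b).submatrix id h)
      rw [hr, ← Fintype.card_coe, rank_eq_finrank_span_cols,
        ← Set.finrank, ← linearIndependent_iff_card_le_finrank_span,
        linearIndependent_cols_iff_isUnit, isUnit_iff_isUnit_det] at h2
      exact h2.ne_zero hd

/-- A minor of a standard-form matrix is a maximal minor. -/
theorem det_submatrix_eq_det_extend {V K : Type*} [DecidableEq V] [Field K] {B : Finset V}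
    (Z : Matrix B V K) (hZ : ∀ b b' : B, Z b b' = if b = b' then 1 else 0) {k : ℕ}
    {f : Fin k → B} (hf : Function.Injective f) (g : Fin k → V) :
    (Z.submatrix f g).det = (Z.submatrix id (Function.extend f g (↑))).det := by
  classical
  rw [twoBlockTriangular_det' (Z.submatrix id (Function.extend f g (↑)))
    (fun b => ∃ t, f t = b)]
  · have h2 : toSquareBlockProp (Z.submatrix id (Function.extend f g (↑)))
        (fun b => ¬ ∃ t, f t = b) = 1 := by
      ext ⟨i, hi⟩ ⟨j, hj⟩
      have : Function.extend f g (fun b : B => (b : V)) j = j := Function.extend_apply' _ _ _ hj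
      simp [toSquareBlockProp, this, hZ, one_apply]
    let e : Fin k ≃ {b // ∃ t, f t = b} := Equiv.ofInjective f hf
    rw [h2, det_one, mul_one]
    refine Eq.trans ?_ (det_submatrix_equiv_self e _)
    have he : ∀ i, (e i : B) = f i := fun _ => rfl
    congr 1
    ext i j
    simp [toSquareBlockProp, he, hf.extend_apply]
  · intro i hi j hj
    have : Function.extend f g (fun b : B => (b : V)) j = j := Function.extend_apply' _ _ _ hj
    rw [submatrix_apply, this, id, hZ, if_neg]
    rintro rfl
    exact hj hi

/-- A matroid representable over `𝔽₂` and `𝔽₃` has a matrix over any field whose maximal minors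
are `±1` on bases and vanish elsewhere. -/
theorem exists_unimodular_matrix {M : Matroid E} (h2 : Representable M (ZMod 2))
    (h3 : Representable M (ZMod 3)) {B : Finset E} (hB : M.r B = B.card) (hBE : M.r B = M.r univ)
    (K : Type) [Field K] :
    ∃ U : Matrix B E K, ∀ h : B → E,
      (U.submatrix id h).det ^ 2 = if M.r (univ.image h) = M.r univ then 1 else 0 := by
  obtain ⟨Y, hY1, hY⟩ := exists_standard_representation h2 hB hBE
  obtain ⟨Z, hZ1, hZ⟩ := exists_standard_representation h3 hB hBE
  have hYZ : ∀ (k : ℕ) (f : Fin k → B) (g : Fin k → E),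
      (Z.submatrix f g).det = 0 ↔ (Y.submatrix f g).det = 0 := by
    intro k f g
    by_cases hf : Function.Injective f
    · rw [det_submatrix_eq_det_extend Y hY1 hf, det_submatrix_eq_det_extend Z hZ1 hf,
        ← not_iff_not]
      exact (hZ _).trans (hY _).symm
    · simp only [Function.Injective, not_forall] at hf
      obtain ⟨a, b, hab, hne⟩ := hf
      rw [det_zero_of_row_eq hne (by ext; simp [hab]), det_zero_of_row_eq hne (by ext; simp [hab])]
      simp
  let X : Matrix B E ℤ := of fun b e => (Z b e).valMinAbs
  have hXZ : X.map (Int.cast : ℤ → ZMod 3) = Z := by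
    ext b e
    simp [X]
  have hXY : X.map (Int.cast : ℤ → ZMod 2) = Y := by
    ext b e
    have h := hYZ 1 ![b] ![e]
    simp only [det_unique, submatrix_apply, Fin.default_eq_zero, cons_val_zero] at h
    simp only [map_apply, X, of_apply]
    generalize Z b e = x at h
    generalize Y b e = y at h
    revert h
    revert x y
    decide
  have hdet : ∀ (R : Type) [CommRing R] (l : Type) [Fintype l] [DecidableEq l] (f : l → B)
      (g : l → E), ((X.submatrix f g).det : R) = ((X.map (Int.cast : ℤ → R)).submatrix f g).det := by
    intro R _ l _ _ f g
    exact (Int.castRingHom R).map_det _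
  have hTU : ∀ h : B → E, |(X.submatrix id h).det| ≤ 1 := by
    intro h
    rw [← det_submatrix_equiv_self (Fintype.equivFin B).symm]
    refine abs_det_submatrix_le_one_s5 _ X ?_ ?_ _ _
    · intro i j
      simp only [X, of_apply]
      generalize Z i j = x
      revert x
      decide
    · intro l f g
      have e2 := hdet (ZMod 2) _ f g
      have e3 := hdet (ZMod 3) _ f g
      rw [hXY] at e2
      rw [hXZ] at e3
      have := hYZ l f g
      rw [← e2, ← e3, ZMod.intCast_zmod_eq_zero_iff_dvd, ZMod.intCast_zmod_eq_zero_iff_dvd] at this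
      exact_mod_cast this
  refine ⟨X.map (Int.cast : ℤ → K), fun h => ?_⟩
  rw [← hdet]
  have e3 := hdet (ZMod 3) _ id h
  rw [hXZ] at e3
  have hb := hTU h
  rw [abs_le] at hb
  have hcases : (X.submatrix id h).det = 0 ∨ (X.submatrix id h).det = 1 ∨
    (X.submatrix id h).det = -1 := by omega
  have hz := hZ h
  rw [← e3] at hz
  rcases hcases with hc | hc | hc <;> rw [hc] at hz ⊢ <;> simp at hz ⊢ <;> simp [hz]

end TotallyUnimodular

section Restriction

open Finset

theorem r_eq_r_univ_of_forall_insert {M : Matroid E} {A : Finset E}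
    (h : ∀ e, M.r (insert e A) = M.r A) : M.r A = M.r univ := by
  have key : ∀ S : Finset E, M.r (A ∪ S) = M.r A := by
    intro S
    induction S using Finset.induction_on with
    | empty => simp
    | insert e S _ ih =>
      have h1 := M.r_submod (A ∪ S) (insert e A)
      have h2 : A ∪ S ∪ insert e A = A ∪ insert e S := by
        ext x
        simp only [mem_union, mem_insert]
        tauto
      have h3 : M.r A ≤ M.r ((A ∪ S) ∩ insert e A) :=
        M.r_mono (subset_inter subset_union_left (subset_insert e A))
      have h4 : M.r A ≤ M.r (A ∪ insert e S) := M.r_mono subset_union_left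
      rw [h2, h e, ih] at h1
      omega
  rw [← key univ, union_eq_right.2 (subset_univ A)]

theorem mem_restrBases {M : Matroid E} {A S : Finset E} :
    S ∈ restrBases M A ↔ S ⊆ A ∧ M.r S = S.card ∧ M.r S = M.r A := by
  simp [restrBases]

/-- Adding a coloop does not change `sbar`. -/
theorem sbar_insert_of_r_ne {F : Type} [Field F] {M : Matroid E} {A : Finset E} {e : E}
    (h : M.r (insert e A) ≠ M.r A) (α : E → F) : sbar M (insert e A) α = sbar M A α := by
  have heA : e ∉ A := fun he => h (by rw [insert_eq_of_mem he])
  have hlt : M.r A < M.r (insert e A) := lt_of_le_of_ne (M.r_mono (subset_insert e A)) h.symm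
  have r_insert_le : ∀ S : Finset E, M.r (insert e S) ≤ M.r S + 1 := fun S => by
    have h1 := M.r_submod S {e}
    have h2 := M.r_le_card {e}
    rw [union_comm, ← insert_eq] at h1
    rw [card_singleton] at h2
    omega
  have hA := r_insert_le A
  have hmem : ∀ S ∈ restrBases M (insert e A), e ∈ S := by
    intro S hS
    obtain ⟨h1, -, h3⟩ := mem_restrBases.1 hS
    by_contra he
    have := M.r_mono ((subset_insert_iff_of_notMem he).1 h1)
    omega
  unfold sbar
  refine sum_bij' (fun S _ => S.erase e) (fun S _ => insert e S) ?_ ?_ ?_ ?_ ?_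
  · intro S hS
    have he := hmem S hS
    obtain ⟨h1, h2, h3⟩ := mem_restrBases.1 hS
    have h4 := r_insert_le (S.erase e)
    have h5 := M.r_le_card (S.erase e)
    have h6 := card_erase_add_one he
    rw [insert_erase he] at h4
    refine mem_restrBases.2 ⟨subset_insert_iff.1 h1, ?_, ?_⟩ <;> omega
  · intro S hS
    obtain ⟨h1, h2, h3⟩ := mem_restrBases.1 hS
    have heS : e ∉ S := fun he => heA (h1 he)
    have h4 := r_insert_le S
    have h5 := M.r_submod (insert e S) A
    have h6 : M.r (insert e A) ≤ M.r (insert e S ∪ A) :=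
      M.r_mono (insert_subset (mem_union_left _ (mem_insert_self e S)) subset_union_right)
    have h7 : M.r S ≤ M.r (insert e S ∩ A) :=
      M.r_mono (subset_inter (subset_insert e S) h1)
    have h8 := card_insert_of_notMem heS
    refine mem_restrBases.2 ⟨insert_subset_insert e h1, ?_, ?_⟩ <;> omega
  · intro S hS
    exact insert_erase (hmem S hS)
  · intro S hS
    exact erase_insert fun he => heA ((mem_restrBases.1 hS).1 he)
  · intro S hS
    congr 1
    ext x
    simp only [mem_sdiff, mem_insert, mem_erase]
    have := hmem S hS
    constructor
    · rintro ⟨rfl | hx, hxS⟩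
      · exact absurd this hxS
      · exact ⟨hx, fun h => hxS h.2⟩
    · rintro ⟨hx, hxS⟩
      refine ⟨Or.inr hx, fun h => hxS ⟨?_, h⟩⟩
      rintro rfl
      exact heA hx

theorem r_eq_r_univ_of_maximal {F : Type} [Field F] {M : Matroid E} {α : E → F} {A : Finset E}
    (hA : sbar M A α ≠ 0) (hmax : ∀ A' : Finset E, sbar M A' α ≠ 0 → A'.card ≤ A.card) :
    M.r A = M.r univ := by
  refine r_eq_r_univ_of_forall_insert fun e => ?_
  by_contra h
  have h1 := hmax (insert e A) (by rwa [sbar_insert_of_r_ne h])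
  have heA : e ∉ A := fun he => h (by rw [insert_eq_of_mem he])
  rw [card_insert_of_notMem heA] at h1
  omega

end Restriction

section Gram

open Matrix Finset

/-- On spanning sets, `sbar` is a determinant. -/
theorem sbar_eq_prod_mul_det {F : Type} [Field F] {M : Matroid E} {B : Finset E}
    (hB : M.r B = B.card) (hBE : M.r B = M.r univ) {U : Matrix B E F}
    (hU : ∀ h : B → E,
      (U.submatrix id h).det ^ 2 = if M.r (univ.image h) = M.r univ then 1 else 0)
    {α : E → F} (hα : ∀ e, α e ≠ 0) {A : Finset E} (hA : M.r A = M.r univ) :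
    sbar M A α = (∏ e ∈ A, α e) *
      (U * diagonal (fun e => if e ∈ A then (α e)⁻¹ else 0) * Uᵀ).det := by
  rw [det_mul_diagonal_mul_transpose_s5 U _ (fun S => M.r S = S.card ∧ M.r S = M.r univ)]
  · have hsub : restrBases M A ⊆ univ.filter fun S => M.r S = S.card ∧ M.r S = M.r univ := by
      intro S hS
      obtain ⟨-, h2, h3⟩ := mem_restrBases.1 hS
      simp [h2, ← hA, ← h3]
    rw [← sum_subset hsub, mul_sum, sbar]
    · refine sum_congr rfl fun S hS => ?_
      have hSA := (mem_restrBases.1 hS).1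
      rw [← prod_sdiff hSA, mul_assoc, ← prod_mul_distrib, prod_eq_one (s := S), mul_one]
      intro e he
      rw [if_pos (hSA he), mul_inv_cancel₀ (hα e)]
    · intro S hS hSA
      obtain ⟨-, h2, h3⟩ := mem_filter.1 hS
      rw [mem_restrBases, not_and] at hSA
      obtain ⟨e, heS, heA⟩ := not_subset.1 fun h => hSA h ⟨h2, h3.trans hA.symm⟩
      exact prod_eq_zero heS (if_neg heA)
  · rintro S ⟨h2, h3⟩
    rw [Fintype.card_coe, ← hB, ← h2, h3, hBE]
  · intro h
    rw [hU]
    congr 1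
    have h1 : (univ.image h).card ≤ B.card := by
      simpa using card_image_le (s := univ) (f := h)
    have h2 := M.r_le_card (univ.image h)
    rw [eq_iff_iff]
    constructor
    · intro h3
      exact ⟨by omega, h3⟩
    · exact And.right

/-- A rank-`ι` update of `U * diagonal w * Uᵀ`. -/
theorem det_mul_diagonal_mul_transpose_update {m n ι F : Type*} [Fintype m] [DecidableEq m]
    [Fintype n] [DecidableEq n] [Fintype ι] [DecidableEq ι] [Field F] (U : Matrix m n F)
    {w w' : n → F} (hw : (U * diagonal w * Uᵀ).det ≠ 0) {g : ι → n} (hg : Function.Injective g)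
    {c : ι → F} (hc : ∀ i, c i ≠ 0) (h1 : ∀ i, w' (g i) = w (g i) + c i)
    (h2 : ∀ e, e ∉ Set.range g → w' e = w e) :
    (U * diagonal w' * Uᵀ).det = (U * diagonal w * Uᵀ).det * ((∏ i, c i) *
      (diagonal (fun i => (c i)⁻¹) +
        (Uᵀ * (U * diagonal w * Uᵀ)⁻¹ * U).submatrix g g).det) := by
  set L := U * diagonal w * Uᵀ with hL
  have hsum : U * diagonal w' * Uᵀ =
      L + U.submatrix id g * (diagonal c * (U.submatrix id g)ᵀ) := by
    ext i j
    rw [Matrix.add_apply, hL, ← Matrix.mul_assoc, mul_apply, mul_apply, mul_apply,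
      ← sub_eq_iff_eq_add', ← sum_sub_distrib]
    simp only [mul_diagonal, transpose_apply, submatrix_apply, id]
    symm
    refine Fintype.sum_of_injective g hg _ _ ?_ ?_
    · intro e he
      rw [h2 e he, sub_self]
    · intro t
      rw [h1]
      ring
  have hfac : 1 + diagonal c * (U.submatrix id g)ᵀ * L⁻¹ * U.submatrix id g =
      diagonal c * (diagonal (fun i => (c i)⁻¹) + (Uᵀ * L⁻¹ * U).submatrix g g) := by
    rw [Matrix.mul_add, diagonal_mul_diagonal, Matrix.mul_assoc, Matrix.mul_assoc]
    congr 1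
    · rw [← diagonal_one]
      congr 1
      ext i
      exact (mul_inv_cancel₀ (hc i)).symm
    · rw [Matrix.mul_assoc]
      rfl
  rw [hsum, det_add_mul _ _ hw.isUnit, hfac, det_mul, det_diagonal]

theorem det_fromBlocks_zero₂₂ {ι R : Type*} [Fintype ι] [DecidableEq ι] [CommRing R]
    (P Q S : Matrix ι ι R) :
    (fromBlocks P Q S 0).det = (-1) ^ Fintype.card ι * (Q.det * S.det) := by
  have hJ : (fromBlocks 0 1 (-1) 0 : Matrix (ι ⊕ ι) (ι ⊕ ι) R) =
      fromBlocks 1 1 0 1 * fromBlocks 1 0 (-1) 1 * fromBlocks 1 1 0 1 := by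
    simp [fromBlocks_multiply]
  have h1 : (fromBlocks 0 1 (-1) 0 : Matrix (ι ⊕ ι) (ι ⊕ ι) R).det = 1 := by
    rw [hJ, det_mul, det_mul, det_fromBlocks_zero₂₁, det_fromBlocks_zero₁₂]
    simp
  have h2 : fromBlocks P Q S 0 * fromBlocks 0 1 (-1) 0 = fromBlocks (-Q) P 0 S := by
    simp [fromBlocks_multiply]
  have h3 := congrArg det h2
  rw [det_mul, h1, mul_one, det_fromBlocks_zero₂₁, det_neg] at h3
  rw [h3]
  ring

end Gram

section Exchange

open Matrix Finset

variable {F : Type} [Field F] {M : Matroid E} {α : E → F} {A₁ A₂ : Finset E}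

/-- Two maximum-cardinality subsets with nonzero `sbar` have `sbar` values differing by a square
factor. -/
theorem exists_sbar_eq_mul_sq (hM2 : Representable M (ZMod 2)) (hM3 : Representable M (ZMod 3))
    (hα : ∀ e, α e ≠ 0) (hA₁ : sbar M A₁ α ≠ 0) (hA₂ : sbar M A₂ α ≠ 0)
    (hA₁max : ∀ A : Finset E, sbar M A α ≠ 0 → A.card ≤ A₁.card)
    (hA₂max : ∀ A : Finset E, sbar M A α ≠ 0 → A.card ≤ A₂.card) :
    ∃ s : F, sbar M A₂ α = sbar M A₁ α * s ^ 2 := by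
  have hr₁ := r_eq_r_univ_of_maximal hA₁ hA₁max
  have hr₂ := r_eq_r_univ_of_maximal hA₂ hA₂max
  obtain ⟨B, hB, -⟩ := exists_ne_zero_of_sum_ne_zero hA₁
  obtain ⟨-, hB, hBA⟩ := mem_restrBases.1 hB
  have hBE := hBA.trans hr₁
  obtain ⟨U, hU⟩ := exists_unimodular_matrix hM2 hM3 hB hBE F
  have hdet := fun {A : Finset E} (hA : M.r A = M.r univ) =>
    sbar_eq_prod_mul_det hB hBE hU hα hA
  set w : Finset E → E → F := fun A e => if e ∈ A then (α e)⁻¹ else 0 with hw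
  set L := U * diagonal (w A₁) * Uᵀ with hL
  have hL0 : L.det ≠ 0 := fun h => hA₁ (by rw [hdet hr₁, ← hL, h, mul_zero])
  set G := Uᵀ * L⁻¹ * U with hG
  have hGsymm : ∀ e f, G e f = G f e := by
    have hLT : Lᵀ = L := by
      simp [hL, Matrix.mul_assoc]
    have hGT : Gᵀ = G := by
      rw [hG, transpose_mul, transpose_mul, transpose_nonsing_inv, hLT, transpose_transpose,
        Matrix.mul_assoc]
    intro e f
    exact congrFun (congrFun hGT f) e
  have hsup : ∀ {l : ℕ} (g : Fin (l + 1) → E), Function.Injective g → (∀ i, g i ∉ A₁) →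
      (diagonal (fun i => α (g i)) + G.submatrix g g).det = 0 := by
    intro l g hg hgA
    have hr : M.r (A₁ ∪ univ.image g) = M.r univ :=
      le_antisymm (M.r_mono (subset_univ _)) (hr₁ ▸ M.r_mono subset_union_left)
    have h0 : sbar M (A₁ ∪ univ.image g) α = 0 := by
      by_contra h
      have h1 := hA₁max _ h
      have h2 : A₁ ⊂ A₁ ∪ univ.image g := by
        refine Finset.ssubset_iff_subset_ne.2 ⟨subset_union_left, fun h => hgA 0 ?_⟩
        rw [h]
        exact mem_union_right _ (mem_image_of_mem g (mem_univ 0))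
      exact absurd (card_lt_card h2) (not_lt.2 h1)
    rw [hdet hr, det_mul_diagonal_mul_transpose_update U hL0 hg (c := fun i => (α (g i))⁻¹)
      (fun i => inv_ne_zero (hα _))] at h0
    · simp only [inv_inv] at h0
      have h1 : ∏ e ∈ A₁ ∪ univ.image g, α e ≠ 0 := prod_ne_zero_iff.2 fun e _ => hα e
      have h2 : ∏ i, (α (g i))⁻¹ ≠ 0 := prod_ne_zero_iff.2 fun e _ => inv_ne_zero (hα _)
      rw [mul_eq_zero, or_iff_right h1, ← hL, mul_eq_zero, or_iff_right hL0, mul_eq_zero,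
        or_iff_right h2] at h0
      exact h0
    · intro i
      simp [hw, hgA]
    · intro e he
      have : e ∉ univ.image g := by simpa using he
      simp only [hw, mem_union, this, or_false]
  have hdiag : ∀ e ∉ A₁, α e + G e e = 0 := by
    intro e he
    have h : (diagonal (fun i : Fin 1 => α (![e] i)) + G.submatrix ![e] ![e]).det = 0 :=
      hsup ![e] (fun i j _ => Fin.ext (by omega)) (by simpa using he)
    rw [det_unique, Matrix.add_apply, submatrix_apply, diagonal_apply_eq] at h
    exact h
  have hoff : ∀ e ∉ A₁, ∀ f ∉ A₁, e ≠ f → G e f = 0 := by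
    intro e he f hf hef
    have h := hsup ![e, f] (by
      intro i j hij
      fin_cases i <;> fin_cases j <;> simp_all) (by
      intro i
      fin_cases i <;> simpa)
    rw [det_fin_two] at h
    simp only [Matrix.add_apply, submatrix_apply, diagonal_apply, cons_val_zero, cons_val_one,
      Fin.isValue, zero_ne_one, one_ne_zero, if_true, if_false, hdiag e he, hdiag f hf,
      hGsymm f e] at h
    simpa using h
  obtain ⟨k, hX⟩ : ∃ k, (A₁ \ A₂).card = k := ⟨_, rfl⟩
  have hY : (A₂ \ A₁).card = k := by
    rw [← hX]
    exact card_sdiff_comm (le_antisymm (hA₁max _ hA₂) (hA₂max _ hA₁))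
  let x : Fin k ≃ (A₁ \ A₂ : Finset E) := (equivFinOfCardEq hX).symm
  let y : Fin k ≃ (A₂ \ A₁ : Finset E) := (equivFinOfCardEq hY).symm
  have hx : ∀ i, (x i : E) ∈ A₁ ∧ (x i : E) ∉ A₂ := fun i => mem_sdiff.1 (x i).2
  have hy : ∀ i, (y i : E) ∈ A₂ ∧ (y i : E) ∉ A₁ := fun i => mem_sdiff.1 (y i).2
  let g : Fin k ⊕ Fin k → E := Sum.elim (fun i => (x i : E)) fun i => (y i : E)
  let c : Fin k ⊕ Fin k → F := Sum.elim (fun i => -(α (x i))⁻¹) fun i => (α (y i))⁻¹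
  have hg : Function.Injective g := by
    refine Function.Injective.sumElim (Subtype.val_injective.comp x.injective)
      (Subtype.val_injective.comp y.injective) fun i j h => ?_
    exact (hy j).2 (h ▸ (hx i).1)
  let R : Matrix (Fin k) (Fin k) F := G.submatrix (fun i => (x i : E)) fun i => (y i : E)
  have hupd := det_mul_diagonal_mul_transpose_update U (w := w A₁) (w' := w A₂) hL0 hg (c := c)
    (by rintro (i | i) <;> simp [c, hα])
    (by rintro (i | i) <;> simp [c, g, hw, hx, hy])
    (by
      intro e he
      have h1 : e ∉ A₁ \ A₂ := fun h => he ⟨Sum.inl (x.symm ⟨e, h⟩), by simp [g]⟩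
      have h2 : e ∉ A₂ \ A₁ := fun h => he ⟨Sum.inr (y.symm ⟨e, h⟩), by simp [g]⟩
      have : e ∈ A₂ ↔ e ∈ A₁ := by
        rw [mem_sdiff] at h1 h2
        tauto
      simp only [hw, this])
  have hblock : diagonal (fun i => (c i)⁻¹) + G.submatrix g g =
      fromBlocks (diagonal (fun i => -α (x i)) + G.submatrix (fun i => (x i : E)) fun i => x i)
        R Rᵀ 0 := by
    ext (i | i) (j | j)
    · simp [diagonal_apply, c, g]
    · simp [c, g, R]
    · simp [c, g, R, hGsymm]
    · by_cases hij : i = j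
      · subst hij
        simpa [c, g] using hdiag _ (hy i).2
      · have hne : (y i : E) ≠ y j := fun h => hij (y.injective (Subtype.ext h))
        simpa [c, g, hij] using hoff _ (hy i).2 _ (hy j).2 hne
  have hprodX : ∏ i, α (x i) = ∏ e ∈ A₁ \ A₂, α e := by
    rw [← prod_coe_sort (A₁ \ A₂)]
    exact Fintype.prod_equiv x _ _ fun _ => rfl
  have hprodY : ∏ i, α (y i) = ∏ e ∈ A₂ \ A₁, α e := by
    rw [← prod_coe_sort (A₂ \ A₁)]
    exact Fintype.prod_equiv y _ _ fun _ => rfl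
  have hc : ∏ i, c i = (-1) ^ k * ((∏ e ∈ A₁ \ A₂, α e)⁻¹ * (∏ e ∈ A₂ \ A₁, α e)⁻¹) := by
    rw [Fintype.prod_sum_type, ← hprodX, ← hprodY, ← prod_inv_distrib, ← prod_inv_distrib]
    simp [c, prod_neg, mul_assoc]
  have hX0 : ∏ e ∈ A₁ \ A₂, α e ≠ 0 := prod_ne_zero_iff.2 fun e _ => hα e
  have hY0 : ∏ e ∈ A₂ \ A₁, α e ≠ 0 := prod_ne_zero_iff.2 fun e _ => hα e
  have hsign : ((-1 : F) ^ k) * (-1) ^ k = 1 := by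
    rw [← mul_pow]
    simp
  refine ⟨(∏ e ∈ A₁ \ A₂, α e)⁻¹ * R.det, ?_⟩
  rw [hdet hr₁, hdet hr₂, ← hL, hupd, ← hL, ← hG, hblock, det_fromBlocks_zero₂₂, det_transpose,
    Fintype.card_fin, hc, ← prod_inter_mul_prod_sdiff A₁ A₂ α, ← prod_inter_mul_prod_sdiff A₂ A₁ α,
    inter_comm A₂ A₁]
  field_simp
  linear_combination ((∏ e ∈ A₁ ∩ A₂, α e) * R.det ^ 2) * hsign

end Exchange

/-- If `A₁`, `A₂` are both maximum-cardinality subsets with `s̄(M|A;α) ≠ 0`,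
then `η(s̄(M|A₁;α)) = η(s̄(M|A₂;α))`. -/
theorem eta_sbar_well_defined
    (E : Type) [Fintype E] [DecidableEq E]
    (F : Type) [Field F] [Fintype F] [DecidableEq F]
    (p d : ℕ) (hp : p.Prime) (hpodd : Odd p) (hcard : Fintype.card F = p ^ d)
    (M : Matroid E)
    (hregular : Regular M)
    (hloopless : ∀ e : E, M.r {e} ≠ 0)
    (α : E → F) (hα : ∀ e, α e ≠ 0)
    (A₁ A₂ : Finset E)
    (hA₁ : sbar M A₁ α ≠ 0) (hA₂ : sbar M A₂ α ≠ 0)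
    (hA₁max : ∀ A : Finset E, sbar M A α ≠ 0 → A.card ≤ A₁.card)
    (hA₂max : ∀ A : Finset E, sbar M A α ≠ 0 → A.card ≤ A₂.card) :
    quadraticChar F (sbar M A₁ α) = quadraticChar F (sbar M A₂ α) := by
  obtain ⟨s, hs⟩ := exists_sbar_eq_mul_sq (hregular (ZMod 2)) (hregular (ZMod 3)) hα hA₁ hA₂
    hA₁max hA₂max
  have hs0 : s ≠ 0 := by
    rintro rfl
    exact hA₂ (by rw [hs]; simp)
  rw [hs, map_mul, quadraticChar_sq_one' hs0, mul_one]

end AlphaRepr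
end

section
/- Let 𝙼 be a matrix over a finite field 𝔽_q with rows indexed by a finite set V and columns indexed by a finite set E. Then the number of vectors f ∈ (𝔽_q^*)^E with 𝙼 f = 0 equals ∑_{T⊆E} (−1)^{|E|−|T|} q^{|T| − rank(𝙼_T)}, where 𝙼_T denotes the submatrix of 𝙼 on the columns indexed by T; equivalently, this number equals χ_{M✶}(q) for the column matroid M of 𝙼. -/
/-!
STATEMENT 7: the number of everywhere-nonzero flows of a matrix `𝙼` over `𝔽_q`
equals `∑_{T⊆E} (−1)^{|E|−|T|} q^{|T|−rank 𝙼_T}`, i.e. `χ_{M✶}(q)` for the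
column matroid `M` of `𝙼` (Kung's theorem, Proposition 1 of the paper).
-/

namespace AlphaRepr

variable {V E F : Type} [Fintype V] [Fintype E] [DecidableEq E] [Field F]

/-- The rank of the set of columns of `Mx` indexed by `T`. -/
noncomputable def colRank (Mx : Matrix V E F) (T : Finset E) : ℕ :=
  (Mx.submatrix id (fun j : T => (j : E))).rank

/-- The kernel of a matrix over a finite field has `q ^ (number of columns - rank)` elements. -/
theorem card_ker_mulVecLin {m n K : Type*} [Fintype n] [Field K] [Fintype K]
    (A : Matrix m n K) :
    Nat.card (LinearMap.ker A.mulVecLin) = Fintype.card K ^ (Fintype.card n - A.rank) := by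
  have h := A.mulVecLin.finrank_range_add_finrank_ker
  rw [Module.finrank_fintype_fun_eq_card] at h
  rw [Module.natCard_eq_pow_finrank (K := K), Nat.card_eq_fintype_card, Matrix.rank]
  congr 1
  omega

/-- Multiplying a vector supported on `T` only involves the columns indexed by `T`. -/
theorem mulVec_eq_submatrix_mulVec {m n K : Type*} [Fintype n] [Semiring K]
    (A : Matrix m n K) (T : Finset n) (f : n → K) (hf : ∀ e ∉ T, f e = 0) :
    A.mulVec f =
      (A.submatrix id (fun j : T => (j : n))).mulVec (fun j : T => f j) := by
  ext v
  simp only [Matrix.mulVec, dotProduct, Matrix.submatrix_apply, id_eq]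
  rw [Finset.sum_coe_sort T (fun e => A v e * f e)]
  exact (Finset.sum_subset (Finset.subset_univ T) fun e _ he => by simp [hf e he]).symm

/-- Flows supported on `T` correspond to flows of the submatrix on the columns indexed by `T`. -/
def flowsSupportedEquiv (Mx : Matrix V E F) (T : Finset E) :
    {f : E → F // (∀ e ∉ T, f e = 0) ∧ Mx.mulVec f = 0} ≃
      LinearMap.ker (Mx.submatrix id (fun j : T => (j : E))).mulVecLin where
  toFun f := ⟨fun j => f.1 j, by
    rw [LinearMap.mem_ker, Matrix.mulVecLin_apply, ← mulVec_eq_submatrix_mulVec Mx T f.1 f.2.1,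
      f.2.2]⟩
  invFun g := ⟨fun e => if h : e ∈ T then g.1 ⟨e, h⟩ else 0, by
    have hsupp : ∀ e ∉ T, (if h : e ∈ T then g.1 ⟨e, h⟩ else 0) = 0 := fun e he => dif_neg he
    refine ⟨hsupp, ?_⟩
    rw [mulVec_eq_submatrix_mulVec Mx T _ hsupp]
    simp only [Finset.coe_mem, dite_true, Subtype.coe_eta]
    exact LinearMap.mem_ker.mp g.2⟩
  left_inv f := by
    ext e
    by_cases h : e ∈ T
    · simp [h]
    · simp [h, f.2.1 e h]
  right_inv g := by
    ext j
    simp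

theorem card_flows_supported [Fintype F] [DecidableEq F] (Mx : Matrix V E F) (T : Finset E) :
    (Finset.univ.filter
      (fun f : E → F => (∀ e ∉ T, f e = 0) ∧ Mx.mulVec f = 0)).card =
      Fintype.card F ^ (T.card - colRank Mx T) := by
  rw [← Fintype.card_subtype, ← Nat.card_eq_fintype_card,
    Nat.card_congr (flowsSupportedEquiv Mx T), card_ker_mulVecLin, Fintype.card_coe, colRank]

/-- Inclusion-exclusion for the indicator of the everywhere-nonzero vectors. -/
theorem indicator_nowhere_zero [DecidableEq F] (f : E → F) :
    (if ∀ e, f e ≠ 0 then (1 : ℚ) else 0) =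
      ∑ T : Finset E, (-1 : ℚ) ^ (Fintype.card E - T.card) *
        (if ∀ e ∉ T, f e = 0 then 1 else 0) := by
  have h : (if ∀ e, f e ≠ 0 then (1 : ℚ) else 0) =
      ∏ e, (1 + -(if f e = 0 then (1 : ℚ) else 0)) := by
    rw [← Fintype.prod_boole]
    exact Finset.prod_congr rfl fun e _ => by by_cases he : f e = 0 <;> simp [he]
  rw [h, Finset.prod_add, Finset.powerset_univ]
  refine Finset.sum_congr rfl fun T _ => ?_
  rw [Finset.prod_const_one, one_mul, Finset.prod_neg, Finset.prod_boole,
    ← Finset.compl_eq_univ_sdiff, Finset.card_compl]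
  simp only [Finset.mem_compl]

/-- **Proposition 1 of the paper.** -/
theorem card_nowhere_zero_flows
    (V E : Type) [Fintype V] [Fintype E] [DecidableEq V] [DecidableEq E]
    (F : Type) [Field F] [Fintype F] [DecidableEq F]
    (Mx : Matrix V E F) :
    ((Finset.univ.filter
        (fun f : E → F => (∀ e, f e ≠ 0) ∧ Mx.mulVec f = 0)).card : ℚ) =
      ∑ T : Finset E,
        (-1 : ℚ) ^ (Fintype.card E - T.card) *
          (Fintype.card F : ℚ) ^ (T.card - colRank Mx T) := by
  have hcard (p : (E → F) → Prop) [DecidablePred p] :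
      ((Finset.univ.filter (fun f : E → F => p f ∧ Mx.mulVec f = 0)).card : ℚ) =
        ∑ f ∈ Finset.univ.filter (fun f : E → F => Mx.mulVec f = 0), if p f then 1 else 0 := by
    rw [Finset.sum_boole, Finset.filter_filter]
    simp only [and_comm]
  rw [hcard, Finset.sum_congr rfl fun f _ => indicator_nowhere_zero f, Finset.sum_comm]
  refine Finset.sum_congr rfl fun T _ => ?_
  rw [← Finset.mul_sum, ← hcard, card_flows_supported, Nat.cast_pow]

end AlphaRepr
end

section
/- Let q = p^d with p an odd prime, let ψ be a nontrivial additive character of 𝔽_q, and set g₁(ψ) = ∑_{x∈𝔽_q} ψ(x²). Let C be a symmetric n×n matrix over 𝔽_q of rank r, and let C_r be any principal r×r submatrix of C with det C_r ≠ 0 (for r = 0 set det C_r = 1). Then ∑_{x ∈ 𝔽_q^n} ψ(x C xᵀ) = q^{n−r} · η(det C_r) · g₁(ψ)^r. -/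
/-!
STATEMENT 9: the multidimensional Gaussian sum of a symmetric matrix `C` of
rank `r` over `𝔽_q` (odd `q`) equals `q^{n−r} · η(det C_r) · g₁(ψ)^r`, where
`C_r` is any nonsingular principal `r×r` submatrix (Lemma 4 of the paper).
-/

open Matrix

open Module

section

variable {F : Type*} [Field F] [Fintype F] [DecidableEq F]

/-- The quadratic exponential sum of a nontrivial additive character is the Gauss sum of the
quadratic character. -/
lemma AddChar.sum_sq_eq_gaussSum (hF : ringChar F ≠ 2) {ψ : AddChar F ℂ} (hψ : ψ ≠ 1) :
    ∑ x, ψ (x ^ 2) = gaussSum ((quadraticChar F).ringHomComp (Int.castRingHom ℂ)) ψ := by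
  have key (y : F) : ∑ x with x ^ 2 = y, ψ (x ^ 2) = ((quadraticChar F y : ℤ) : ℂ) * ψ y + ψ y := by
    rw [Finset.sum_congr rfl (g := fun _ ↦ ψ y) (by simp +contextual), Finset.sum_const,
      nsmul_eq_mul]
    have h := quadraticChar_card_sqrts hF y
    rw [Set.toFinset_ofPred] at h
    rw [← Int.cast_natCast, h]
    push_cast
    ring
  rw [← Finset.sum_fiberwise (g := fun x : F ↦ x ^ 2)]
  simp_rw [key]
  rw [Finset.sum_add_distrib, AddChar.sum_eq_zero_of_ne_one hψ, add_zero]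
  rfl

lemma AddChar.sum_mul_sq (hF : ringChar F ≠ 2) {ψ : AddChar F ℂ} (hψ : ψ ≠ 1) {a : F}
    (ha : a ≠ 0) :
    ∑ x, ψ (a * x ^ 2) = ((quadraticChar F a : ℤ) : ℂ) * ∑ x, ψ (x ^ 2) := by
  have hshift : ψ.mulShift a ≠ 1 := AddChar.IsPrimitive.of_ne_one hψ ha
  have h1 := AddChar.sum_sq_eq_gaussSum hF hshift
  have h2 := gaussSum_mulShift ((quadraticChar F).ringHomComp (Int.castRingHom ℂ)) ψ
    (Units.mk0 a ha)
  have h3 : ((quadraticChar F a : ℤ) : ℂ) * ((quadraticChar F a : ℤ) : ℂ) = 1 := by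
    rw [← sq]
    exact_mod_cast quadraticChar_sq_one ha
  simp only [AddChar.mulShift_apply] at h1
  rw [AddChar.sum_sq_eq_gaussSum hF hψ, ← h2, h1]
  simp only [MulChar.ringHomComp_apply, Units.val_mk0, eq_intCast]
  rw [← mul_assoc, h3, one_mul]

lemma AddChar.map_sum_eq_prod {G M κ : Type*} [AddCommMonoid G] [CommMonoid M] (ψ : AddChar G M)
    (s : Finset κ) (f : κ → G) : ψ (∑ i ∈ s, f i) = ∏ i ∈ s, ψ (f i) :=
  map_prod ψ.toMonoidHom (fun i ↦ Multiplicative.ofAdd (f i)) s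

/-- The Gaussian sum of a nonsingular symmetric matrix. -/
lemma AddChar.sum_quadratic_of_det_ne_zero (hF : ringChar F ≠ 2) {ψ : AddChar F ℂ} (hψ : ψ ≠ 1)
    {ι : Type*} [Fintype ι] [DecidableEq ι] {A : Matrix ι ι F} (hA : A.IsSymm)
    (hdet : A.det ≠ 0) :
    ∑ x : ι → F, ψ (x ⬝ᵥ A.mulVec x) =
      ((quadraticChar F A.det : ℤ) : ℂ) * (∑ x, ψ (x ^ 2)) ^ Fintype.card ι := by
  have : Invertible (2 : F) := invertibleOfNonzero (Ring.two_ne_zero hF)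
  set B := Matrix.toBilin' A with hB
  have hBsymm : LinearMap.IsSymm B := by
    refine ⟨fun x y ↦ ?_⟩
    simp only [hB, Matrix.toBilin'_apply', RingHom.id_apply]
    rw [dotProduct_mulVec, ← mulVec_transpose, hA.eq, dotProduct_comm]
  obtain ⟨v₀, hv₀⟩ := LinearMap.BilinForm.exists_orthogonal_basis hBsymm
  let e : Fin (finrank F (ι → F)) ≃ ι := Fintype.equivOfCardEq (by simp)
  let v := v₀.reindex e
  have hv (i j : ι) (hij : i ≠ j) : B (v i) (v j) = 0 := by
    simp only [v, Basis.reindex_apply]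
    exact hv₀ (e.symm.injective.ne hij)
  let w : ι → F := fun i ↦ B (v i) (v i)
  have hdiag : LinearMap.BilinForm.toMatrix v B = diagonal w := by
    ext i j
    rw [LinearMap.BilinForm.toMatrix_apply]
    by_cases hij : i = j
    · subst hij; simp [w]
    · rw [hv i j hij, diagonal_apply_ne _ hij]
  set P := (Pi.basisFun F ι).toMatrix v
  have hPdet : P.det ≠ 0 := ((Pi.basisFun F ι).isUnit_det v).ne_zero
  have hprod : ∏ i, w i = P.det ^ 2 * A.det := by
    have h := LinearMap.BilinForm.toMatrix_mul_basis_toMatrix (Pi.basisFun F ι) v B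
    rw [hdiag, LinearMap.BilinForm.toMatrix_basisFun, hB,
      LinearMap.BilinForm.toMatrix'_toBilin'] at h
    rw [← det_diagonal, ← h]
    simp only [det_mul, det_transpose]
    ring
  have hw (i : ι) : w i ≠ 0 := by
    have : ∏ i, w i ≠ 0 := hprod ▸ mul_ne_zero (pow_ne_zero _ hPdet) hdet
    exact Finset.prod_ne_zero_iff.mp this i (Finset.mem_univ i)
  have hform (c : ι → F) : B (v.equivFun.symm c) (v.equivFun.symm c) = ∑ i, w i * c i ^ 2 := by
    simp only [Basis.equivFun_symm_apply, map_sum, map_smul, LinearMap.sum_apply,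
      LinearMap.smul_apply, smul_eq_mul]
    refine Finset.sum_congr rfl fun i _ ↦ ?_
    rw [Finset.sum_eq_single i]
    · simp only [w]; ring
    · intro j _ hj
      simp [hv j i hj]
    · simp
  calc ∑ x : ι → F, ψ (x ⬝ᵥ A.mulVec x)
      = ∑ c : ι → F, ∏ i, ψ (w i * c i ^ 2) := by
        rw [← v.equivFun.symm.toEquiv.sum_comp]
        refine Finset.sum_congr rfl fun c _ ↦ ?_
        rw [← AddChar.map_sum_eq_prod, ← hform, hB, Matrix.toBilin'_apply']
        rfl
    _ = ∏ i, ∑ x, ψ (w i * x ^ 2) := by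
        rw [Finset.prod_univ_sum, Fintype.piFinset_univ]
    _ = _ := by
        simp_rw [AddChar.sum_mul_sq hF hψ (hw _)]
        rw [Finset.prod_mul_distrib, Finset.prod_const, Finset.card_univ]
        congr 1
        rw [← Int.cast_prod, ← map_prod, hprod, map_mul, map_pow, quadraticChar_sq_one hPdet,
          one_mul]

end

/-- Summing a function of a surjective linear map over its domain. -/
lemma LinearMap.sum_comp_of_surjective {F V W R : Type*} [Field F] [Fintype F] [AddCommGroup V] [Module F V] [Fintype V]
    [AddCommGroup W] [Module F W] [Fintype W] [CommSemiring R]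
    (f : V →ₗ[F] W) (hf : Function.Surjective f) (φ : W → R) :
    ∑ x, φ (f x) = (Fintype.card F : R) ^ (finrank F V - finrank F W) * ∑ y, φ y := by
  classical
  have hker : finrank F (LinearMap.ker f) = finrank F V - finrank F W := by
    have h := f.finrank_range_add_finrank_ker
    rw [LinearMap.range_eq_top.mpr hf, finrank_top] at h
    omega
  have hfiber (y : W) : Finset.card {x | f x = y} =
      Fintype.card F ^ (finrank F V - finrank F W) := by
    rw [AddMonoidHom.card_fiber_eq_of_mem_range f (hf y) (hf 0), ← hker,
      ← Module.card_eq_pow_finrank, ← Fintype.card_subtype]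
    exact Fintype.card_congr (Equiv.refl _)
  rw [Finset.sum_comp, Finset.image_univ_of_surjective hf, Finset.mul_sum]
  refine Finset.sum_congr rfl fun y _ ↦ ?_
  rw [hfiber, nsmul_eq_mul, Nat.cast_pow]

/-- A symmetric matrix is recovered from the rows indexed by a nonsingular principal submatrix
of full rank. -/
lemma Matrix.IsSymm.eq_transpose_mul_inv_mul {K ι : Type*} [Field K] [Fintype ι] [DecidableEq ι]
    {C : Matrix ι ι K} (hC : C.IsSymm) {S : Finset ι} (hScard : S.card = C.rank)
    (hSdet : (C.submatrix (fun i : S ↦ (i : ι)) (fun j : S ↦ (j : ι))).det ≠ 0) :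
    C = (C.submatrix (fun i : S ↦ (i : ι)) id)ᵀ *
      (C.submatrix (fun i : S ↦ (i : ι)) (fun j : S ↦ (j : ι)))⁻¹ *
      C.submatrix (fun i : S ↦ (i : ι)) id := by
  set R := C.submatrix (fun i : S ↦ (i : ι)) id with hR
  set A := C.submatrix (fun i : S ↦ (i : ι)) (fun j : S ↦ (j : ι)) with hA
  have hunit : IsUnit A.det := hSdet.isUnit
  set E : Matrix ι S K := (1 : Matrix ι ι K).submatrix id (fun j : S ↦ (j : ι)) with hE
  have hRE : R * E = A := by
    ext i j
    simp [R, E, A, Matrix.mul_apply, Matrix.one_apply]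
  have hCE : C * E = Rᵀ := by
    ext i j
    simp [R, E, Matrix.mul_apply, Matrix.one_apply, hC.apply]
  have hRrank : R.rank = C.rank := by
    refine le_antisymm (rank_submatrix_le C _ _) ?_
    calc C.rank = A.rank := by
          rw [rank_of_isUnit A ((isUnit_iff_isUnit_det A).mpr hunit), ← hScard, Fintype.card_coe]
      _ ≤ R.rank := by rw [← hRE]; exact rank_mul_le_left R E
  have hker : LinearMap.ker C.mulVecLin = LinearMap.ker R.mulVecLin := by
    refine Submodule.eq_of_le_of_finrank_eq (fun x hx ↦ ?_) ?_
    · rw [LinearMap.mem_ker, mulVecLin_apply] at hx ⊢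
      ext i
      exact congrFun hx i
    · have h1 := C.mulVecLin.finrank_range_add_finrank_ker
      have h2 := R.mulVecLin.finrank_range_add_finrank_ker
      simp only [Matrix.rank] at hRrank
      omega
  have hzero : C * (1 - E * A⁻¹ * R) = 0 := by
    have hRzero : R * (1 - E * A⁻¹ * R) = 0 := by
      rw [Matrix.mul_sub, Matrix.mul_one, ← Matrix.mul_assoc, ← Matrix.mul_assoc, hRE,
        Matrix.mul_nonsing_inv _ hunit, Matrix.one_mul, sub_self]
    refine ext_of_mulVec_single fun i ↦ ?_
    rw [← mulVec_mulVec, zero_mulVec, ← mulVecLin_apply, ← LinearMap.mem_ker, hker,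
      LinearMap.mem_ker, mulVecLin_apply, mulVec_mulVec, hRzero, zero_mulVec]
  rw [Matrix.mul_sub, Matrix.mul_one, sub_eq_zero] at hzero
  rw [← hCE, Matrix.mul_assoc C, Matrix.mul_assoc C]
  exact hzero


/-- **Lemma 4 of the paper.** -/
theorem gauss_sum_symmetric_matrix
    (F : Type) [Field F] [Fintype F] [DecidableEq F]
    (p d : ℕ) (hp : p.Prime) (hpodd : Odd p) (hcard : Fintype.card F = p ^ d)
    (ψ : AddChar F ℂ) (hψ : ψ ≠ 1)
    (n : ℕ) (C : Matrix (Fin n) (Fin n) F) (hC : C.IsSymm)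
    (S : Finset (Fin n)) (hScard : S.card = C.rank)
    (hSdet : (C.submatrix (fun i : S => (i : Fin n)) (fun j : S => (j : Fin n))).det ≠ 0) :
    ∑ x : Fin n → F, ψ (x ⬝ᵥ C.mulVec x) =
      (Fintype.card F : ℂ) ^ (n - C.rank) *
        ((quadraticChar F
            ((C.submatrix (fun i : S => (i : Fin n)) (fun j : S => (j : Fin n))).det) : ℤ) : ℂ) *
        (∑ x : F, ψ (x ^ 2)) ^ C.rank := by
  have hF : ringChar F ≠ 2 := fun h ↦ by
    have h1 := FiniteField.even_card_of_char_two h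
    have h2 := Nat.odd_iff.mp (hcard ▸ hpodd.pow : Odd (Fintype.card F))
    omega
  set A := C.submatrix (fun i : S => (i : Fin n)) (fun j : S => (j : Fin n)) with hA
  set R := C.submatrix (fun i : S => (i : Fin n)) id with hR
  have hunit : IsUnit A.det := hSdet.isUnit
  have hAsymm : A⁻¹.IsSymm := (hC.submatrix _).inv
  have hAinv : A⁻¹.det = A.det⁻¹ := by rw [det_nonsing_inv, Ring.inverse_eq_inv]
  have hAinvdet : A⁻¹.det ≠ 0 := hAinv ▸ inv_ne_zero hSdet
  have hη : quadraticChar F A⁻¹.det = quadraticChar F A.det := by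
    have h : A⁻¹.det = A.det * A⁻¹.det ^ 2 := by
      rw [hAinv]
      field_simp
    rw [h, map_mul, map_pow, quadraticChar_sq_one hAinvdet, mul_one]
  have hsurj : Function.Surjective R.mulVecLin := by
    intro y
    refine ⟨((1 : Matrix (Fin n) (Fin n) F).submatrix id (fun j : S => (j : Fin n)) * A⁻¹) *ᵥ y, ?_⟩
    have hRE : R * (1 : Matrix (Fin n) (Fin n) F).submatrix id (fun j : S => (j : Fin n)) = A := by
      ext i j
      simp [R, A, Matrix.mul_apply, Matrix.one_apply]
    rw [mulVecLin_apply, mulVec_mulVec, ← Matrix.mul_assoc, hRE, mul_nonsing_inv _ hunit,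
      one_mulVec]
  have hform (x : Fin n → F) :
      x ⬝ᵥ C.mulVec x = R.mulVecLin x ⬝ᵥ A⁻¹.mulVec (R.mulVecLin x) := by
    conv_lhs => rw [hC.eq_transpose_mul_inv_mul hScard hSdet]
    rw [← hA, ← hR, ← mulVec_mulVec, ← mulVec_mulVec, dotProduct_mulVec, vecMul_transpose,
      mulVecLin_apply]
  simp_rw [hform]
  rw [R.mulVecLin.sum_comp_of_surjective hsurj (fun y ↦ ψ (y ⬝ᵥ A⁻¹.mulVec y)),
    AddChar.sum_quadratic_of_det_ne_zero hF hψ hAsymm hAinvdet, hη]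
  simp only [finrank_fintype_fun_eq_card, Fintype.card_fin, Fintype.card_coe, hScard]
  ring
end

section
/- Let q be odd and let C be a symmetric n×n matrix over 𝔽_q of rank r. If C_r and C_r' are any two principal r×r submatrices of C with det C_r ≠ 0 and det C_r' ≠ 0, then η(det C_r) = η(det C_r'). -/
/-!
STATEMENT 10: for a symmetric matrix `C` of rank `r` over `𝔽_q` (`q` odd), the
quadratic character of the determinant of a nonsingular principal `r×r`
submatrix does not depend on the choice of the submatrix
(Corollary 2 of the paper).
-/

namespace Matrix

variable {K m ι : Type*} [Field K] [Fintype m] [Fintype ι] [DecidableEq ι]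

/-- Rows meeting a nonsingular square submatrix of size `A.rank` span all rows of `A`. -/
theorem exists_eq_mul_submatrix_id_of_det_ne_zero {A : Matrix m m K} {f : ι → m}
    (hcard : Fintype.card ι = A.rank) (hdet : (A.submatrix f f).det ≠ 0) :
    ∃ P : Matrix m ι K, A = P * A.submatrix f id := by
  have hli : LinearIndependent K (fun i => A.row (f i)) :=
    LinearIndependent.of_comp (LinearMap.funLeft K K f)
      (linearIndependent_rows_of_det_ne_zero hdet)
  have hspan : Submodule.span K (Set.range fun i => A.row (f i)) =
      Submodule.span K (Set.range A.row) := by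
    apply Submodule.eq_of_le_of_finrank_eq
    · apply Submodule.span_mono
      rintro _ ⟨i, rfl⟩
      exact ⟨f i, rfl⟩
    · rw [finrank_span_eq_card hli, hcard, rank_eq_finrank_span_row]
  have hrow (k : m) : ∃ c : ι → K, ∑ i, c i • A.row (f i) = A.row k := by
    rw [← Submodule.mem_span_range_iff_exists_fun, hspan]
    exact Submodule.subset_span ⟨k, rfl⟩
  choose P hP using hrow
  refine ⟨of P, ?_⟩
  ext k j
  simpa [mul_apply] using (congrFun (hP k) j).symm

/-- A symmetric matrix with a nonsingular principal submatrix `B` of size its rank is of the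
form `P * B * Pᵀ`. -/
theorem IsSymm.exists_eq_mul_submatrix_mul_transpose {A : Matrix m m K} (hA : A.IsSymm)
    {f : ι → m} (hcard : Fintype.card ι = A.rank) (hdet : (A.submatrix f f).det ≠ 0) :
    ∃ P : Matrix m ι K, A = P * A.submatrix f f * Pᵀ := by
  obtain ⟨P, hP⟩ := exists_eq_mul_submatrix_id_of_det_ne_zero hcard hdet
  refine ⟨P, ?_⟩
  have hcols : A.submatrix id f = P * A.submatrix f f := by
    conv_lhs => rw [hP]
    rfl
  have hrows : A.submatrix f id = (A.submatrix id f)ᵀ := by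
    rw [transpose_submatrix, hA.eq]
  rw [hcols, transpose_mul, transpose_submatrix, hA.eq] at hrows
  rw [Matrix.mul_assoc, ← hrows]
  exact hP

/-- Two principal minors of a symmetric matrix of size its rank, the first of them nonzero,
differ by a square factor. -/
theorem IsSymm.exists_det_submatrix_eq_sq_mul {κ : Type*} [Fintype κ] [DecidableEq κ]
    {A : Matrix m m K} (hA : A.IsSymm) {f : ι → m} {g : κ → m}
    (hf : Fintype.card ι = A.rank) (hg : Fintype.card κ = A.rank)
    (hdet : (A.submatrix f f).det ≠ 0) :
    ∃ c : K, (A.submatrix g g).det = c ^ 2 * (A.submatrix f f).det := by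
  obtain ⟨P, hP⟩ := hA.exists_eq_mul_submatrix_mul_transpose hf hdet
  let e : κ ≃ ι := Fintype.equivOfCardEq (hg.trans hf.symm)
  let Q : Matrix ι ι K := P.submatrix (g ∘ e.symm) id
  have hQ : (A.submatrix g g).submatrix e.symm e.symm = Q * A.submatrix f f * Qᵀ := by
    generalize A.submatrix f f = B at hP
    rw [hP]
    rfl
  refine ⟨Q.det, ?_⟩
  rw [← det_submatrix_equiv_self e.symm, hQ, det_mul, det_mul, det_transpose]
  ring

end Matrix

/-- **Corollary 2 of the paper.** -/
theorem eta_principal_minor_well_defined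
    (F : Type) [Field F] [Fintype F] [DecidableEq F]
    (hq : Odd (Fintype.card F))
    (n : ℕ) (C : Matrix (Fin n) (Fin n) F) (hC : C.IsSymm)
    (S S' : Finset (Fin n))
    (hS : S.card = C.rank) (hS' : S'.card = C.rank)
    (hSdet : (C.submatrix (fun i : S => (i : Fin n)) (fun j : S => (j : Fin n))).det ≠ 0)
    (hS'det : (C.submatrix (fun i : S' => (i : Fin n)) (fun j : S' => (j : Fin n))).det ≠ 0) :
    quadraticChar F
        ((C.submatrix (fun i : S => (i : Fin n)) (fun j : S => (j : Fin n))).det) =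
      quadraticChar F
        ((C.submatrix (fun i : S' => (i : Fin n)) (fun j : S' => (j : Fin n))).det) := by
  obtain ⟨c, hc⟩ := hC.exists_det_submatrix_eq_sq_mul
    (f := fun i : S => (i : Fin n)) (g := fun i : S' => (i : Fin n))
    (by simpa using hS) (by simpa using hS') hSdet
  have hc0 : c ≠ 0 := by
    rintro rfl
    exact hS'det (by simpa using hc)
  rw [hc, map_mul, quadraticChar_sq_one' hc0, one_mul]
end

section
/- Let q be odd, let ψ be a nontrivial additive character of 𝔽_q, and let C : 𝔽_q^k → {symmetric n×n matrices over 𝔽_q} be a linear map (i.e., every entry of C(α) is a linear form in α). Then ∑_{α ∈ (𝔽_q^*)^k, rank C(α) odd} ∑_{x ∈ 𝔽_q^n} ψ(x C(α) xᵀ) = 0. -/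
/-!
STATEMENT 12: for a linear family `α ↦ C(α)` of symmetric matrices over `𝔽_q`
(`q` odd), the Gaussian sums over the everywhere-nonzero `α` for which
`rank C(α)` is odd cancel out (Corollary 3 of the paper).
-/

open Matrix

/-- Counting square roots with the quadratic character. -/
lemma sum_comp_sq_eq_sum_quadraticChar {F : Type*} [Field F] [Fintype F] [DecidableEq F]
    (hF : ringChar F ≠ 2) (f : F → ℂ) :
    ∑ t, f (t ^ 2) = ∑ s, ((quadraticChar F s : ℂ) + 1) * f s := by
  rw [← Finset.sum_fiberwise (s := Finset.univ) (g := fun t : F => t ^ 2)]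
  refine Finset.sum_congr rfl fun s _ => ?_
  have h := quadraticChar_card_sqrts hF s
  have h' : ({x : F | x ^ 2 = s}.toFinset) = Finset.univ.filter (fun x : F => x ^ 2 = s) := by
    ext; simp
  rw [h'] at h
  rw [Finset.sum_congr rfl (g := fun _ => f s) (by intro x hx; simp_all), Finset.sum_const,
    nsmul_eq_mul]
  congr 1
  exact_mod_cast h

/-- Twisting a sum over squares by a nonsquare negates it, if the function has sum zero. -/
lemma sum_comp_nonsquare_mul_sq {F : Type*} [Field F] [Fintype F] [DecidableEq F]
    (hF : ringChar F ≠ 2) {g : F} (hg : quadraticChar F g = -1) (f : F → ℂ)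
    (hf : ∑ s, f s = 0) :
    ∑ t, f (g * t ^ 2) = -∑ t, f (t ^ 2) := by
  have hg0 : g ≠ 0 := by rintro rfl; simp at hg
  have h : ∑ t, f (g * t ^ 2) = ∑ s, (1 - (quadraticChar F s : ℂ)) * f s := by
    rw [sum_comp_sq_eq_sum_quadraticChar hF (fun s => f (g * s)),
      ← Equiv.sum_comp (Equiv.mulLeft₀ g hg0) (fun s => (1 - (quadraticChar F s : ℂ)) * f s)]
    refine Finset.sum_congr rfl fun s _ => ?_
    change _ = (1 - (quadraticChar F (g * s) : ℂ)) * f (g * s)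
    rw [map_mul, hg]
    push_cast
    ring
  rw [h, sum_comp_sq_eq_sum_quadraticChar hF, eq_neg_iff_add_eq_zero, ← Finset.sum_add_distrib]
  calc _ = ∑ s, 2 * f s := Finset.sum_congr rfl fun s _ => by ring
    _ = 0 := by rw [← Finset.mul_sum, hf, mul_zero]

lemma sum_addChar_nonsquare_mul_mul_sq {F : Type*} [Field F] [Fintype F] [DecidableEq F]
    (hF : ringChar F ≠ 2) {ψ : AddChar F ℂ} (hψ : ψ ≠ 1) {g : F}
    (hg : quadraticChar F g = -1) {w : F} (hw : w ≠ 0) :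
    ∑ t, ψ (g * w * t ^ 2) = -∑ t, ψ (w * t ^ 2) := by
  have h := sum_comp_nonsquare_mul_sq hF hg (fun s => ψ (w * s)) (by
    exact (Equiv.sum_comp (Equiv.mulLeft₀ w hw) ψ).trans (AddChar.sum_eq_zero_of_ne_one hψ))
  rw [← h]
  exact Finset.sum_congr rfl fun t _ => by ring_nf

/-- A symmetric matrix over a field of characteristic not two is congruent to a diagonal one. -/
lemma Matrix.IsSymm.exists_transpose_mul_mul_eq_diagonal {K : Type*} [Field K] (h2 : (2 : K) ≠ 0)
    {n : ℕ} {A : Matrix (Fin n) (Fin n) K} (hA : A.IsSymm) :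
    ∃ (P : Matrix (Fin n) (Fin n) K) (w : Fin n → K),
      IsUnit P.det ∧ Pᵀ * A * P = Matrix.diagonal w := by
  have : Invertible (2 : K) := invertibleOfNonzero h2
  obtain ⟨v, hv⟩ := LinearMap.BilinForm.exists_orthogonal_basis
    (LinearMap.BilinForm.isSymm_iff.mp
      ((Matrix.isSymm_toBilin_iff_isSymm (Pi.basisFun K (Fin n))).mpr hA))
  let e : Fin (Module.finrank K (Fin n → K)) ≃ Fin n := finCongr (by simp)
  let u := v.reindex e
  let B := Matrix.toBilin (Pi.basisFun K (Fin n)) A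
  refine ⟨(Pi.basisFun K (Fin n)).toMatrix u, fun i => B (u i) (u i), ?_, ?_⟩
  · have := (Pi.basisFun K (Fin n)).invertibleToMatrix u
    exact Matrix.isUnit_det_of_invertible _
  · have h := LinearMap.BilinForm.toMatrix_mul_basis_toMatrix (Pi.basisFun K (Fin n)) u B
    rw [LinearMap.BilinForm.toMatrix_toBilin] at h
    rw [h]
    ext i j
    rw [LinearMap.BilinForm.toMatrix_apply]
    by_cases hij : i = j
    · subst hij; simp
    · rw [Matrix.diagonal_apply_ne _ hij]
      simp only [u, Module.Basis.reindex_apply]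
      exact hv (e.symm.injective.ne hij)

lemma sum_addChar_quadratic_eq_prod {F : Type*} [Field F] [Fintype F]
    (ψ : AddChar F ℂ) {n : ℕ} {A P : Matrix (Fin n) (Fin n) F} {w : Fin n → F}
    (hP : IsUnit P.det) (h : Pᵀ * A * P = Matrix.diagonal w) :
    ∑ x : Fin n → F, ψ (x ⬝ᵥ A.mulVec x) = ∏ i, ∑ t, ψ (w i * t ^ 2) := by
  classical
  have hbij : Function.Bijective P.mulVec :=
    Finite.injective_iff_bijective.mp
      (Matrix.mulVec_injective_iff_isUnit.mpr ((Matrix.isUnit_iff_isUnit_det P).mpr hP))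
  rw [← hbij.sum_comp (fun x => ψ (x ⬝ᵥ A.mulVec x)), Finset.prod_univ_sum,
    Fintype.piFinset_univ]
  refine Finset.sum_congr rfl fun y _ => ?_
  have hy : P.mulVec y ⬝ᵥ A.mulVec (P.mulVec y) = ∑ i, w i * y i ^ 2 := by
    rw [← Matrix.vecMul_transpose P y, ← Matrix.dotProduct_mulVec, Matrix.vecMul_transpose, Matrix.mulVec_mulVec,
      Matrix.mulVec_mulVec, h]
    simp only [dotProduct, Matrix.mulVec_diagonal]
    exact Finset.sum_congr rfl fun i _ => by ring
  rw [hy]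
  exact map_prod ψ.toMonoidHom (fun i => Multiplicative.ofAdd (w i * y i ^ 2)) Finset.univ

/-- Scaling an odd-rank quadratic form by a nonsquare negates its exponential sum. -/
lemma sum_addChar_quadratic_nonsquare_smul {F : Type*} [Field F] [Fintype F] [DecidableEq F]
    (hF : ringChar F ≠ 2) {ψ : AddChar F ℂ} (hψ : ψ ≠ 1) {g : F}
    (hg : quadraticChar F g = -1) {n : ℕ} {A : Matrix (Fin n) (Fin n) F} (hA : A.IsSymm)
    (hodd : Odd A.rank) :
    ∑ x : Fin n → F, ψ (x ⬝ᵥ (g • A).mulVec x) = -∑ x : Fin n → F, ψ (x ⬝ᵥ A.mulVec x) := by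
  obtain ⟨P, w, hP, h⟩ := hA.exists_transpose_mul_mul_eq_diagonal (Ring.two_ne_zero hF)
  have hg' : Pᵀ * (g • A) * P = Matrix.diagonal (g • w) := by
    rw [Matrix.mul_smul, Matrix.smul_mul, h, Matrix.diagonal_smul]
  have hrank : A.rank = (Finset.univ.filter fun i => w i ≠ 0).card := by
    rw [← Fintype.card_subtype, ← Matrix.rank_diagonal, ← h,
      Matrix.rank_mul_eq_left_of_isUnit_det _ _ hP,
      Matrix.rank_mul_eq_right_of_isUnit_det _ _ (by rwa [Matrix.det_transpose])]
  rw [sum_addChar_quadratic_eq_prod ψ hP h, sum_addChar_quadratic_eq_prod ψ hP hg']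
  have hterm : ∀ i, ∑ t, ψ ((g • w) i * t ^ 2) =
      (if w i ≠ 0 then -1 else 1) * ∑ t, ψ (w i * t ^ 2) := by
    intro i
    by_cases hw : w i = 0
    · simp [hw]
    · simp [hw, sum_addChar_nonsquare_mul_mul_sq hF hψ hg hw]
  rw [Finset.prod_congr rfl fun i _ => hterm i, Finset.prod_mul_distrib, ← Finset.prod_filter,
    Finset.prod_const, ← hrank, hodd.neg_one_pow, neg_one_mul]

/-- **Corollary 3 of the paper.** -/
theorem gauss_sum_odd_rank_vanishes
    (F : Type) [Field F] [Fintype F] [DecidableEq F]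
    (hq : Odd (Fintype.card F))
    (ψ : AddChar F ℂ) (hψ : ψ ≠ 1)
    (k n : ℕ)
    (C : (Fin k → F) →ₗ[F] Matrix (Fin n) (Fin n) F)
    (hsymm : ∀ α : Fin k → F, (C α).IsSymm) :
    ∑ α ∈ Finset.univ.filter
        (fun α : Fin k → F => (∀ i, α i ≠ 0) ∧ Odd (C α).rank),
      ∑ x : Fin n → F, ψ (x ⬝ᵥ (C α).mulVec x) = 0 := by
  have hF : ringChar F ≠ 2 := fun h => by
    rw [Nat.odd_iff, FiniteField.even_card_of_char_two h] at hq
    exact zero_ne_one hq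
  obtain ⟨g, hg⟩ := quadraticChar_exists_neg_one hF
  have hg0 : g ≠ 0 := by rintro rfl; simp at hg
  rw [← self_eq_neg, ← Finset.sum_neg_distrib]
  symm
  refine Finset.sum_equiv (MulAction.toPerm (Units.mk0 g hg0)) (fun α => ?_) (fun α hα => ?_)
  · have hrank : (C (g • α)).rank = (C α).rank := by
      rw [map_smul]
      exact Matrix.rank_smul_of_mem_nonZeroDivisors _ (mem_nonZeroDivisors_of_ne_zero hg0)
    rw [Finset.mem_filter, Finset.mem_filter, MulAction.toPerm_apply, Units.smul_def,
      Units.val_mk0, hrank]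
    simp [hg0]
  · rw [MulAction.toPerm_apply, Units.smul_def, Units.val_mk0, map_smul]
    exact (sum_addChar_quadratic_nonsquare_smul hF hψ hg (hsymm α)
      (Finset.mem_filter.mp hα).2.2).symm
end

section
/- Let ψ be a nontrivial additive character of a finite field 𝔽_q and let 𝙼 be a matrix over 𝔽_q with rows indexed by a finite set V and columns indexed by a finite set E. For α ∈ (𝔽_q^*)^E let Λ(α) be the E×E diagonal matrix with diagonal entries α_e. Then q^{|V|} · #{ x ∈ (𝔽_q^*)^E : 𝙼 x = 0 } = ∑_{α ∈ (𝔽_q^*)^E} ∑_{k ∈ 𝔽_q^V} ψ( k (𝙼 Λ(α) 𝙼ᵀ) kᵀ ). -/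
/-!
STATEMENT 14: the key identity of the α-representation technique:
`q^{|V|} · #{x ∈ (𝔽_q^*)^E : 𝙼x = 0} = ∑_{α nowhere zero} ∑_k ψ(k (𝙼Λ(α)𝙼ᵀ) kᵀ)`.
-/

open Matrix

/-- Orthogonality of characters: summing `ψ (k ⬝ᵥ y)` over all `k` detects `y = 0`. -/
theorem AddChar.sum_dotProduct_eq_ite {V F : Type*} [Fintype V] [DecidableEq V]
    [Field F] [Fintype F] [DecidableEq F] {ψ : AddChar F ℂ} (hψ : ψ ≠ 1) (y : V → F) :
    ∑ k : V → F, ψ (k ⬝ᵥ y) =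
      if y = 0 then (Fintype.card F : ℂ) ^ Fintype.card V else 0 := by
  split_ifs with hy
  · simp [hy]
  · let f : (V → F) →+ F :=
      { toFun := fun k => k ⬝ᵥ y
        map_zero' := zero_dotProduct y
        map_add' := fun a b => add_dotProduct a b y }
    have hf : ψ.compAddMonoidHom f ≠ 1 := by
      obtain ⟨t, ht⟩ := AddChar.ne_one_iff.mp hψ
      obtain ⟨v, hv⟩ := Function.ne_iff.mp hy
      refine AddChar.ne_one_iff.mpr ⟨Pi.single v (t / y v), ?_⟩
      have hv' : y v ≠ 0 := hv
      simpa [f, hv'] using ht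
    exact AddChar.sum_eq_zero_of_ne_one hf

/-- Rescaling each coordinate by `c e` where it is nonzero permutes the nowhere zero vectors. -/
theorem sum_nowhere_zero_dotProduct_eq_sum_sq {E F M : Type*} [Fintype E] [DecidableEq E]
    [Field F] [Fintype F] [DecidableEq F] [AddCommMonoid M] (g : F → M) (c : E → F) :
    ∑ x : E → F with ∀ e, x e ≠ 0, g (∑ e, c e * x e) =
      ∑ a : E → F with ∀ e, a e ≠ 0, g (∑ e, c e ^ 2 * a e) := by
  let d : E → F := fun e => if c e = 0 then 1 else c e
  have hd : ∀ e, d e ≠ 0 := fun e => by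
    by_cases h : c e = 0 <;> simp [d, h]
  have hcd : ∀ e, c e * d e = c e ^ 2 := fun e => by
    by_cases h : c e = 0 <;> simp [d, h, sq]
  symm
  refine Finset.sum_nbij' (fun a e => d e * a e) (fun x e => (d e)⁻¹ * x e) ?_ ?_ ?_ ?_ ?_
  · intro a ha
    simpa [hd] using ha
  · intro x hx
    simpa [hd] using hx
  · intro a _
    funext e
    simp [hd]
  · intro x _
    funext e
    simp [hd]
  · intro a _
    simp only [← mul_assoc, hcd]

/-- Diagonalization of the quadratic form of `A * diagonal a * Aᵀ`. -/
theorem Matrix.dotProduct_mul_diagonal_mul_transpose_mulVec {V E R : Type*} [Fintype V]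
    [Fintype E] [DecidableEq E] [CommRing R] (A : Matrix V E R) (a : E → R) (k : V → R) :
    k ⬝ᵥ (A * diagonal a * Aᵀ) *ᵥ k = ∑ e, (k ᵥ* A) e ^ 2 * a e := by
  rw [← mulVec_mulVec, ← mulVec_mulVec, dotProduct_mulVec, mulVec_transpose]
  simp only [dotProduct, mulVec_diagonal]
  exact Finset.sum_congr rfl fun e _ => by ring

theorem alpha_representation_key_identity
    (V E : Type) [Fintype V] [Fintype E] [DecidableEq V] [DecidableEq E]
    (F : Type) [Field F] [Fintype F] [DecidableEq F]
    (ψ : AddChar F ℂ) (hψ : ψ ≠ 1)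
    (Mx : Matrix V E F) :
    (Fintype.card F : ℂ) ^ (Fintype.card V) *
        ((Finset.univ.filter
            (fun x : E → F => (∀ e, x e ≠ 0) ∧ Mx.mulVec x = 0)).card : ℂ) =
      ∑ α ∈ Finset.univ.filter (fun α : E → F => ∀ e, α e ≠ 0),
        ∑ k : V → F,
          ψ (k ⬝ᵥ (Mx * Matrix.diagonal α * Mx.transpose).mulVec k) := by
  simp only [Matrix.dotProduct_mul_diagonal_mul_transpose_mulVec]
  rw [Finset.sum_comm]
  simp only [← sum_nowhere_zero_dotProduct_eq_sum_sq]
  rw [Finset.sum_comm, ← Finset.filter_filter, Finset.card_filter, Nat.cast_sum, Finset.mul_sum]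
  refine Finset.sum_congr rfl fun x _ => ?_
  have h := AddChar.sum_dotProduct_eq_ite hψ (Mx *ᵥ x)
  simp only [dotProduct_mulVec] at h
  refine Eq.trans ?_ h.symm
  simp
end

section
/- Let q = p^d with p an odd prime. Then ∑_{α ∈ (𝔽_q^*)^4} η( α₁α₂ + α₁α₃ + α₁α₄ + α₂α₃ + α₂α₄ + 4α₃α₄ ) = η(−1) · q · (q−1)(q−4). -/
/-!
STATEMENT 15: the quadratic-character identity arising from the
α-representation of the uniform matroid `U_{2,4}` (Example 3 of the paper):
`∑_{α ∈ (𝔽_q^*)^4} η(α₁α₂+α₁α₃+α₁α₄+α₂α₃+α₂α₄+4α₃α₄) = η(−1)·q·(q−1)(q−4)`.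
-/

open Finset

section

variable {F : Type*} [Field F] [Fintype F] [DecidableEq F]

/-- The sum of the quadratic character over the nonzero values of the variable of an
affine function. -/
theorem sum_erase_quadraticChar_affine (hF : ringChar F ≠ 2) (s t : F) :
    ∑ a ∈ univ.erase (0 : F), quadraticChar F (a * s + t) =
      (if s = 0 then (Fintype.card F : ℤ) * quadraticChar F t else 0) - quadraticChar F t := by
  have h : ∑ a, quadraticChar F (a * s + t) =
      if s = 0 then (Fintype.card F : ℤ) * quadraticChar F t else 0 := by
    split_ifs with hs
    · simp [hs]
    · rw [← quadraticChar_sum_zero hF]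
      exact Fintype.sum_equiv ((Equiv.mulRight₀ s hs).trans (Equiv.addRight t)) _ _
        fun _ => rfl
  rw [← h, ← add_sum_erase univ _ (mem_univ (0 : F))]
  simp

theorem quadraticChar_mul_sq (x : F) {y : F} (hy : y ≠ 0) :
    quadraticChar F (x * y ^ 2) = quadraticChar F x := by
  rw [map_mul, quadraticChar_sq_one' hy, mul_one]

/-- The sum over nonzero `a` and `b`, with `c` and `d ≠ 0` fixed. -/
theorem sum_sum_quadraticChar_U24 (hF : ringChar F ≠ 2) (c : F) {d : F} (hd : d ≠ 0) :
    ∑ b ∈ univ.erase (0 : F), ∑ a ∈ univ.erase (0 : F),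
        quadraticChar F (a * b + a * c + a * d + b * c + b * d + 4 * (c * d)) =
      Fintype.card F * quadraticChar F (-1) *
          (1 - 2 * (if c = -d then 1 else 0) - (if c = d then 1 else 0)) +
        quadraticChar F c * quadraticChar F d := by
  have h2 : (2 : F) ≠ 0 := Ring.two_ne_zero hF
  have hinner (b : F) : ∑ a ∈ univ.erase (0 : F),
        quadraticChar F (a * b + a * c + a * d + b * c + b * d + 4 * (c * d)) =
      (if b = -(c + d) then
        (Fintype.card F : ℤ) * quadraticChar F (b * (c + d) + 4 * (c * d)) else 0) -
        quadraticChar F (b * (c + d) + 4 * (c * d)) := by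
    have h := sum_erase_quadraticChar_affine hF (b + (c + d)) (b * (c + d) + 4 * (c * d))
    simp only [add_eq_zero_iff_eq_neg] at h
    rw [← h]
    exact sum_congr rfl fun a _ => congrArg _ (by ring)
  have hprod : quadraticChar F (4 * (c * d)) = quadraticChar F c * quadraticChar F d := by
    rw [← map_mul, ← quadraticChar_mul_sq (c * d) h2]
    exact congrArg _ (by ring)
  have hdisc : -(c + d) * (c + d) + 4 * (c * d) = -1 * (c - d) ^ 2 := by ring
  simp only [hinner, sum_sub_distrib, sum_ite_eq', mem_erase, mem_univ, and_true,
    sum_erase_quadraticChar_affine hF, hdisc, hprod, neg_ne_zero]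
  by_cases h1 : c = -d
  · have hne : -d ≠ d := fun h => mul_ne_zero h2 hd (by linear_combination -h)
    have hm : quadraticChar F (-d) * quadraticChar F d = quadraticChar F (-1) := by
      rw [← map_mul, ← quadraticChar_mul_sq (-1) hd]
      exact congrArg _ (by ring)
    simp only [h1, neg_add_cancel, hm, hne, ne_eq, not_true_eq_false, if_true, if_false]
    ring
  · have hs : c + d ≠ 0 := fun h => h1 (eq_neg_of_add_eq_zero_left h)
    by_cases h3 : c = d
    · subst h3
      simp [h1, hs]
    · simp [h1, hs, h3, quadraticChar_mul_sq (-1) (sub_ne_zero.2 h3), -neg_mul, -one_mul]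

end

/-- **Example 3 of the paper.** -/
theorem U24_character_sum
    (F : Type) [Field F] [Fintype F] [DecidableEq F]
    (p d : ℕ) (hp : p.Prime) (hpodd : Odd p) (hcard : Fintype.card F = p ^ d) :
    (∑ α ∈ Finset.univ.filter (fun α : Fin 4 → F => ∀ i, α i ≠ 0),
        (quadraticChar F
          (α 0 * α 1 + α 0 * α 2 + α 0 * α 3 + α 1 * α 2 + α 1 * α 3 +
            4 * (α 2 * α 3)) : ℤ)) =
      quadraticChar F (-1) * (Fintype.card F : ℤ) *
        ((Fintype.card F : ℤ) - 1) * ((Fintype.card F : ℤ) - 4) := by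
  have hF : ringChar F ≠ 2 := by
    rw [Ne, FiniteField.even_card_iff_char_two, hcard, ← Nat.even_iff, Nat.not_even_iff_odd]
    exact hpodd.pow
  have htuples : (∑ α ∈ Finset.univ.filter (fun α : Fin 4 → F => ∀ i, α i ≠ 0),
        quadraticChar F
          (α 0 * α 1 + α 0 * α 2 + α 0 * α 3 + α 1 * α 2 + α 1 * α 3 + 4 * (α 2 * α 3))) =
      ∑ d ∈ univ.erase (0 : F), ∑ c ∈ univ.erase (0 : F),
        ∑ b ∈ univ.erase (0 : F), ∑ a ∈ univ.erase (0 : F),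
          quadraticChar F (a * b + a * c + a * d + b * c + b * d + 4 * (c * d)) := by
    simp only [← sum_product']
    refine sum_nbij' (fun α => (α 3, α 2, α 1, α 0))
      (fun x => ![x.2.2.2, x.2.2.1, x.2.1, x.1]) ?_ ?_ ?_ ?_ ?_
    · intro α hα
      simp_all
    · rintro ⟨d, c, b, a⟩ h
      simp_all [Fin.forall_fin_succ]
    · intro α _
      ext i
      fin_cases i <;> rfl
    · intro x _
      rfl
    · intro α _
      rfl
  have hchar : ∑ c ∈ univ.erase (0 : F), quadraticChar F c = 0 := by
    rw [sum_erase _ (by simp), quadraticChar_sum_zero hF]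
  have hcardErase : ((univ.erase (0 : F)).card : ℤ) = Fintype.card F - 1 := by
    rw [cast_card_erase_of_mem (mem_univ _), card_univ]
  have hcd : ∀ d ∈ univ.erase (0 : F), ∑ c ∈ univ.erase (0 : F),
        ∑ b ∈ univ.erase (0 : F), ∑ a ∈ univ.erase (0 : F),
          quadraticChar F (a * b + a * c + a * d + b * c + b * d + 4 * (c * d)) =
      Fintype.card F * quadraticChar F (-1) * ((Fintype.card F : ℤ) - 4) := by
    intro d hd
    have hd0 := ne_of_mem_erase hd
    rw [sum_congr rfl fun c _ => sum_sum_quadraticChar_U24 hF c hd0,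
      sum_add_distrib, ← sum_mul, hchar, ← mul_sum, sum_sub_distrib, sum_sub_distrib,
      ← mul_sum, sum_ite_eq', sum_ite_eq', if_pos hd,
      if_pos (mem_erase.2 ⟨neg_ne_zero.2 hd0, mem_univ _⟩), sum_const, nsmul_one, hcardErase]
    ring
  rw [htuples, sum_congr rfl hcd, sum_const, nsmul_eq_mul, hcardErase]
  ring
end
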